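/- Let P be the matroid polytope of a Lagrangian matroid M, equipped with an orientation of P (each short edge directed so that every 2-dimensional face of P has equally many short edges directed clockwise and anti-clockwise). Fix a fundamental basis F and assign signs s(F,·) to bases as follows: s(F,F) = +1; any two bases joined by an inducing edge (relative to F) get opposite signs; any two bases joined by a non-inducing edge get the same sign. Then: (1) this assignment is contradiction-free, so a sign s(F,A) is well defined for every basis A; and (2) s(F,·) is an orientation of M relative to F, and different fundamental bases give equivalent orientations, related by s(G,A) = s(F,A)·s(F,G)·(−1)^{|G∖(F∪A)|}, so that an oriented Lagrangian matroid polytope uniquely determines an oriented Lagrangian matroid. -/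

import Mathlib

open Finset Matrix
open scoped Classical

/-- The index set `J = I ∪ I*`: the element `(i, false)` represents the unstarred
index `i+1`, and `(i, true)` represents the starred index `(i+1)*`. -/
abbrev JJ (n : ℕ) := Fin n × Bool

/-- The involution `* : J → J`. -/
def starJ {n : ℕ} (x : JJ n) : JJ n := (x.1, !x.2)

/-- A subset `A ⊆ J` is admissible iff `A ∩ A* = ∅`. -/
def AdmissibleSet {n : ℕ} (A : Finset (JJ n)) : Prop := ∀ x ∈ A, starJ x ∉ A

/-- An admissible permutation of `J`: one commuting with `*`.  These form the
hyperoctahedral group `W = BC_n`. -/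
def AdmissiblePerm {n : ℕ} (w : Equiv.Perm (JJ n)) : Prop := ∀ x, w (starJ x) = starJ (w x)

/-- The standard ordering `n* < … < 1* < 1 < … < n` on `J`, encoded by a value in `ℤ`. -/
def ordJ {n : ℕ} (x : JJ n) : ℤ := if x.2 then -((x.1 : ℤ) + 1) else (x.1 : ℤ) + 1

/-- The ordering `≤^w` on `J`: `x ≤^w y` iff `w⁻¹ x ≤ w⁻¹ y` in the standard order. -/
def leW {n : ℕ} (w : Equiv.Perm (JJ n)) (x y : JJ n) : Prop :=
  ordJ (w.symm x) ≤ ordJ (w.symm y)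

/-- The (Gale) ordering induced by `≤^w` on admissible subsets: `A ≼^w B` iff the
sorted lists dominate componentwise, equivalently iff there is a bijection
`f : A → B` with `a ≤^w f a` for all `a ∈ A`. -/
def setLE {n : ℕ} (w : Equiv.Perm (JJ n)) (A B : Finset (JJ n)) : Prop :=
  ∃ f : JJ n → JJ n, Set.BijOn f ↑A ↑B ∧ ∀ a ∈ A, leW w a (f a)

/-- `ℬ` is the collection of bases of a symplectic matroid of rank `k`: all members
are admissible `k`-sets, and for every admissible permutation `w` there is a
(necessarily unique) `≤^w`-maximal member (the Maximality Property). -/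
def IsSymplecticMatroid {n : ℕ} (k : ℕ) (ℬ : Finset (Finset (JJ n))) : Prop :=
  (∀ A ∈ ℬ, AdmissibleSet A ∧ A.card = k) ∧
  ∀ w : Equiv.Perm (JJ n), AdmissiblePerm w → ∃ A ∈ ℬ, ∀ B ∈ ℬ, setLE w B A

/-- A Lagrangian matroid is a symplectic matroid of rank `n`. -/
def IsLagrangianMatroid {n : ℕ} (ℬ : Finset (Finset (JJ n))) : Prop :=
  IsSymplecticMatroid n ℬ
/-- The vector `e_j ∈ ℝ^n` for `j ∈ J`: `e_i` for unstarred `i`, `-e_i` for starred. -/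
def eVec {n : ℕ} (x : JJ n) : Fin n → ℝ :=
  fun i => if i = x.1 then (if x.2 then -1 else 1) else 0

/-- The point `e_A = Σ_{j ∈ A} e_j ∈ ℝ^n` associated to an admissible set `A`. -/
def eSet {n : ℕ} (A : Finset (JJ n)) : Fin n → ℝ := ∑ x ∈ A, eVec x

/-- The matroid polytope: the convex hull of the points `e_A`, `A ∈ ℬ`. -/
def matroidPolytope {n : ℕ} (ℬ : Finset (Finset (JJ n))) : Set (Fin n → ℝ) :=
  convexHull ℝ (eSet '' ↑ℬ)

/-- Bases `A` and `B` are joined by an edge of the matroid polytope: there is a linear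
functional taking equal maximal values at `e_A`, `e_B` and strictly smaller values at
all other vertices. -/
def IsEdge {n : ℕ} (ℬ : Finset (Finset (JJ n))) (A B : Finset (JJ n)) : Prop :=
  A ∈ ℬ ∧ B ∈ ℬ ∧ A ≠ B ∧
  ∃ L : (Fin n → ℝ) →ₗ[ℝ] ℝ, L (eSet A) = L (eSet B) ∧
    ∀ C ∈ ℬ, C ≠ A → C ≠ B → L (eSet C) < L (eSet A)

/-- The height of `A` relative to the fundamental basis `F`: `h(A) = n - |A ∩ F|`. -/
def heightF {n : ℕ} (F A : Finset (JJ n)) : ℕ := n - (A ∩ F).card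

/-- A short edge: an edge whose ends are related by a short exchange `A = B ∆ {i,i*}`. -/
def IsShortEdge {n : ℕ} (ℬ : Finset (Finset (JJ n))) (A B : Finset (JJ n)) : Prop :=
  IsEdge ℬ A B ∧ ∃ i : JJ n, symmDiff A B = ({i, starJ i} : Finset (JJ n))

/-- A long edge: an edge whose ends are related by a long exchange
`A = B ∆ {i,i*,j,j*}`, `i ∉ {j,j*}`. -/
def IsLongEdge {n : ℕ} (ℬ : Finset (Finset (JJ n))) (A B : Finset (JJ n)) : Prop :=
  IsEdge ℬ A B ∧ ∃ i j : JJ n, i ≠ j ∧ i ≠ starJ j ∧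
    symmDiff A B = ({i, starJ i, j, starJ j} : Finset (JJ n))

/-- The four bases of a 2-dimensional face of the matroid polytope which is a square
with short edges (type sSquare): `A`, `A ∆ {i,i*}`, `A ∆ {j,j*}`, `A ∆ {i,i*,j,j*}`,
all of them bases. -/
def ShortSquare {n : ℕ} (ℬ : Finset (Finset (JJ n))) (v : Fin 4 → Finset (JJ n)) : Prop :=
  ∃ (A : Finset (JJ n)) (i j : JJ n), i.1 ≠ j.1 ∧
    v 0 = A ∧ v 1 = symmDiff A ({i, starJ i} : Finset (JJ n)) ∧
    v 2 = symmDiff A ({j, starJ j} : Finset (JJ n)) ∧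
    v 3 = symmDiff A ({i, starJ i, j, starJ j} : Finset (JJ n)) ∧
    ∀ k : Fin 4, v k ∈ ℬ

/-- `sF` is an orientation of the Lagrangian matroid with bases `ℬ` relative to the
fundamental basis `F`: it takes values `±1` on bases and satisfies axioms (i)–(iv). -/
def IsOrientationRel {n : ℕ} (ℬ : Finset (Finset (JJ n))) (F : Finset (JJ n))
    (sF : Finset (JJ n) → ℤ) : Prop :=
  (∀ A ∈ ℬ, sF A = 1 ∨ sF A = -1) ∧
  (∀ A B : Finset (JJ n), IsLongEdge ℬ A B → heightF F A = heightF F B → sF A = sF B) ∧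
  (∀ A B : Finset (JJ n), IsLongEdge ℬ A B → heightF F A ≠ heightF F B → sF A = -sF B) ∧
  (∀ v : Fin 4 → Finset (JJ n), ShortSquare ℬ v →
    ∀ k : Fin 4,
      ((∀ l m : Fin 4, l ≠ k → m ≠ k → sF (v l) = sF (v m)) ∧
        ∃ l : Fin 4, l ≠ k ∧ sF (v l) ≠ sF (v k)) →
      (∀ l : Fin 4, heightF F (v l) ≤ heightF F (v k)) ∨
      (∀ l : Fin 4, heightF F (v k) ≤ heightF F (v l))) ∧
  sF F = 1

/-- `(ℬ, s)` is an oriented Lagrangian matroid: `s` vanishes when an argument is not a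
basis, each `s G` is an orientation relative to `G`, and the change-of-fundamental-basis
rule holds. -/
def IsOrientation {n : ℕ} (ℬ : Finset (Finset (JJ n)))
    (s : Finset (JJ n) → Finset (JJ n) → ℤ) : Prop :=
  (∀ G A : Finset (JJ n), G ∉ ℬ ∨ A ∉ ℬ → s G A = 0) ∧
  (∀ G ∈ ℬ, IsOrientationRel ℬ G (s G)) ∧
  (∀ G ∈ ℬ, ∀ H ∈ ℬ, ∀ A ∈ ℬ, s G A = s H A * s H G * (-1) ^ ((G \ (H ∪ A)).card))
/-- An increasing path of length `p` in the matroid polytope starting at the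
fundamental basis `F`: consecutive vertices are joined by edges and strictly increase
for some linear functional compatible with the height relative to `F`. -/
def IncreasingPath {n : ℕ} (ℬ : Finset (Finset (JJ n))) (F : Finset (JJ n))
    (v : ℕ → Finset (JJ n)) (p : ℕ) : Prop :=
  v 0 = F ∧ (∀ i < p, IsEdge ℬ (v i) (v (i + 1))) ∧
  ∃ L : (Fin n → ℝ) →ₗ[ℝ] ℝ,
    (∀ A ∈ ℬ, ∀ B ∈ ℬ, heightF F B < heightF F A → L (eSet B) < L (eSet A)) ∧
    ∀ i < p, L (eSet (v i)) < L (eSet (v (i + 1)))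

/-- A height-increasing path: consecutive vertices are adjacent in the polytope and
the height relative to `F` strictly increases. -/
def HeightIncreasingPath {n : ℕ} (ℬ : Finset (Finset (JJ n))) (F : Finset (JJ n))
    (v : ℕ → Finset (JJ n)) (p : ℕ) : Prop :=
  v 0 = F ∧ ∀ i < p, IsEdge ℬ (v i) (v (i + 1)) ∧ heightF F (v i) < heightF F (v (i + 1))

/-- `A` is a basis of maximal height relative to `F`. -/
def MaxHeightBasis {n : ℕ} (ℬ : Finset (Finset (JJ n))) (F A : Finset (JJ n)) : Prop :=
  A ∈ ℬ ∧ ∀ B ∈ ℬ, heightF F B ≤ heightF F A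

/-- The number of changes of sign of `sF` along the path `v 0, v 1, …, v p`. -/
def signChanges {n : ℕ} (sF : Finset (JJ n) → ℤ) (v : ℕ → Finset (JJ n)) (p : ℕ) : ℕ :=
  ((Finset.range p).filter fun i => sF (v i) ≠ sF (v (i + 1))).card

/-- A 2-dimensional (exposed) face of the matroid polytope. -/
def Is2Face {n : ℕ} (ℬ : Finset (Finset (JJ n))) (Fc : Set (Fin n → ℝ)) : Prop :=
  IsExposed ℝ (matroidPolytope ℬ) Fc ∧ Module.finrank ℝ (vectorSpan ℝ Fc) = 2

/-- `v 0, …, v (m-1)` is the cycle of vertices (bases) of the 2-dimensional face `Fc`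
of the matroid polytope, consecutive ones (cyclically) being joined by edges. -/
def FaceCycle {n : ℕ} (ℬ : Finset (Finset (JJ n))) (Fc : Set (Fin n → ℝ)) (m : ℕ)
    (v : ℕ → Finset (JJ n)) : Prop :=
  Is2Face ℬ Fc ∧ 3 ≤ m ∧ (∀ i < m, v i ∈ ℬ ∧ eSet (v i) ∈ Fc) ∧
  (∀ A ∈ ℬ, eSet A ∈ Fc → ∃! i : ℕ, i < m ∧ v i = A) ∧
  ∀ i < m, IsEdge ℬ (v i) (v ((i + 1) % m))

/-- An orientation of the Lagrangian matroid polytope: an assignment `ε` of directions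
to short edges (`ε A B = 1` when the edge is directed from `A` to `B`; `ε` vanishes on
non-(short edges)) such that in every 2-dimensional face the number of short edges
directed clockwise equals the number directed anti-clockwise. -/
def IsPolytopeOrientation {n : ℕ} (ℬ : Finset (Finset (JJ n)))
    (ε : Finset (JJ n) → Finset (JJ n) → ℤ) : Prop :=
  (∀ A B : Finset (JJ n), IsShortEdge ℬ A B → (ε A B = 1 ∨ ε A B = -1) ∧ ε B A = -ε A B) ∧
  (∀ A B : Finset (JJ n), ¬IsShortEdge ℬ A B → ε A B = 0) ∧
  ∀ (Fc : Set (Fin n → ℝ)) (m : ℕ) (v : ℕ → Finset (JJ n)), FaceCycle ℬ Fc m v →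
    (∑ i ∈ Finset.range m, ε (v i) (v ((i + 1) % m))) = 0

/-- An inducing edge relative to `F`, for the polytope orientation `ε`: a vertical long
edge, or a short edge directed downwards (from the higher basis to the lower one). -/
def IsInducingEdge {n : ℕ} (ℬ : Finset (Finset (JJ n)))
    (ε : Finset (JJ n) → Finset (JJ n) → ℤ) (F A B : Finset (JJ n)) : Prop :=
  (IsLongEdge ℬ A B ∧ heightF F A ≠ heightF F B) ∨
  (IsShortEdge ℬ A B ∧
    ((heightF F B < heightF F A ∧ ε A B = 1) ∨ (heightF F A < heightF F B ∧ ε B A = 1)))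

/-- The signs `s` are induced from the polytope orientation `ε`: for every fundamental
basis `F`, `s F F = 1`, bases joined by an inducing edge get opposite signs, and bases
joined by a non-inducing edge get the same sign. -/
def InducedBy {n : ℕ} (ℬ : Finset (Finset (JJ n)))
    (ε : Finset (JJ n) → Finset (JJ n) → ℤ)
    (s : Finset (JJ n) → Finset (JJ n) → ℤ) : Prop :=
  ∀ F ∈ ℬ, s F F = 1 ∧ ∀ A B : Finset (JJ n), IsEdge ℬ A B →
    (IsInducingEdge ℬ ε F A B → s F A = -s F B) ∧
    (¬IsInducingEdge ℬ ε F A B → s F A = s F B)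


/-- `S` is nonempty and its largest element lies in `U`. -/
def lowS {n : ℕ} (U S : Finset (Fin n)) : Prop := ∃ m ∈ S, m ∈ U ∧ ∀ x ∈ S, x ≤ m

/-- The candidate values of the potential at the empty set, coming from lower neighbours. -/
def IsVal {n : ℕ} (U : Finset (Fin n)) (D : Finset (Fin n) → Prop) (ψ : Finset (Fin n) → ℤ)
    (e : Finset (Fin n) → Finset (Fin n) → ℤ) (c : ℤ) : Prop :=
  (∃ i, i ∈ U ∧ D {i} ∧ c = ψ {i} - e ∅ {i}) ∨
  (∃ i j, i < j ∧ j ∈ U ∧ D {i, j} ∧ ¬ (D {i} ∧ D {j}) ∧ c = ψ {i, j})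

theorem isVal_unique {n : ℕ} (U : Finset (Fin n)) (D : Finset (Fin n) → Prop)
    (ψ : Finset (Fin n) → ℤ)
    (e : Finset (Fin n) → Finset (Fin n) → ℤ) (h0 : D ∅)
    (hex : ∀ X Y, D X → D Y → ∀ a ∈ symmDiff X Y, ∃ b ∈ symmDiff X Y, D (symmDiff X {a, b}))
    (hs : ∀ X Y i, symmDiff X Y = {i} → D X → D Y → lowS U X → lowS U Y → e X Y = ψ Y - ψ X)
    (hl : ∀ X Y i j, i ≠ j → symmDiff X Y = {i, j} → D X → D Y →
      ¬ (D (symmDiff X {i}) ∧ D (symmDiff X {j})) → lowS U X → lowS U Y → ψ X = ψ Y)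
    (cS : ∀ i j, i ≠ j → D {i} → D {j} → D {i, j} →
      e ∅ {i} + e {i} {i, j} = e ∅ {j} + e {j} {i, j})
    (cT : ∀ i j, i ≠ j → D {i} → D {i, j} → ¬ D {j} → e ∅ {i} + e {i} {i, j} = 0)
    (cT2 : ∀ i j, i ≠ j → D {i} → D {j} → ¬ D {i, j} → e ∅ {i} = e ∅ {j})
    (cR : ∀ i j k, i ≠ j → i ≠ k → j ≠ k → D {i} → D {j, k} → D {i, j, k} →
      ¬ D {k} → ¬ D {i, k} → e ∅ {i} = e {j, k} {i, j, k})
    (c c' : ℤ) (hc : IsVal U D ψ e c) (hc' : IsVal U D ψ e c') : c = c' := by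
  have lw1 : ∀ i, i ∈ U → lowS U {i} := fun i hi => ⟨i, by simp, hi, by simp⟩
  have lw2 : ∀ i j, i < j → j ∈ U → lowS U {i, j} := fun i j h hj =>
    ⟨j, by simp, hj, by simp [h.le]⟩
  have lw2' : ∀ i j, i ∈ U → j ∈ U → lowS U {i, j} := by
    intro i j hi hj
    rcases le_total i j with h | h
    · exact ⟨j, by simp, hj, by simp [h]⟩
    · exact ⟨i, by simp, hi, by simp [h]⟩
  -- single vs single
  have L1 : ∀ i j, i ∈ U → j ∈ U → D {i} → D {j} → ψ {i} - e ∅ {i} = ψ {j} - e ∅ {j} := by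
    intro i j hi hj di dj
    by_cases hij : i = j
    · rw [hij]
    by_cases d : D {i, j}
    · have h1 := hs {i} {i, j} j (by clear * - hij; ext x; grind [Finset.mem_symmDiff]) di d (lw1 i hi) (lw2' i j hi hj)
      have h2 := hs {j} {i, j} i (by clear * - hij; ext x; grind [Finset.mem_symmDiff]) dj d (lw1 j hj) (lw2' i j hi hj)
      have := cS i j hij di dj d
      linarith
    · have h1 := hl {i} {j} i j hij (by clear * - hij; ext x; grind [Finset.mem_symmDiff]) di dj (by
        intro h
        have : symmDiff ({i} : Finset (Fin n)) {j} = {i, j} := by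
          clear * - hij; ext x; grind [Finset.mem_symmDiff]
        rw [this] at h; exact d h.2) (lw1 i hi) (lw1 j hj)
      have := cT2 i j hij di dj d
      linarith
  -- single vs pair containing it
  have LT : ∀ i j, i ≠ j → i ∈ U → lowS U {i, j} → D {i} → D {i, j} → ¬ D {j} →
      ψ {i} - e ∅ {i} = ψ {i, j} := by
    intro i j hij hi hlo di d dj
    have h1 := hs {i} {i, j} j (by clear * - hij; ext x; grind [Finset.mem_symmDiff]) di d (lw1 i hi) hlo
    have := cT i j hij di d dj
    linarith
  -- two pairs sharing an element which is not a basis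
  have LP : ∀ i j k, i ≠ j → i ≠ k → j ≠ k → D {i, k} → D {j, k} → ¬ D {k} →
      lowS U {i, k} → lowS U {j, k} → ψ {i, k} = ψ {j, k} := by
    intro i j k hij hik hjk d1 d2 hk l1 l2
    refine hl _ _ i j hij (by clear * - hij hik hjk; ext x; grind [Finset.mem_symmDiff]) d1 d2 ?_ l1 l2
    intro h
    have : symmDiff ({i, k} : Finset (Fin n)) {i} = {k} := by
      clear * - hij hik hjk; ext x; grind [Finset.mem_symmDiff]
    rw [this] at h; exact hk h.1
  -- single vs pair
  have L2 : ∀ i j k, j < k → i ∈ U → k ∈ U → D {i} → D {j, k} → ¬ (D {j} ∧ D {k}) →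
      ψ {i} - e ∅ {i} = ψ {j, k} := by
    intro i j k hjk hi hk di djk hnot
    by_cases dk : D {k}
    · rw [L1 i k hi hk di dk]
      have := LT k j hjk.ne' hk (by rw [Finset.pair_comm]; exact lw2 j k hjk hk) dk
        (by rw [Finset.pair_comm]; exact djk) (fun h => hnot ⟨h, dk⟩)
      rw [this, Finset.pair_comm]
    have hik : i ≠ k := by rintro rfl; exact dk di
    by_cases hij : i = j
    · subst hij
      exact LT i k hik hi (lw2 i k hjk hk) di djk dk
    by_cases dik : D {i, k}
    · rw [LT i k hik hi (lw2' i k hi hk) di dik dk]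
      exact LP i j k hij hik hjk.ne dik djk dk (lw2' i k hi hk) (lw2 j k hjk hk)
    have dijk : D {i, j, k} := by
      obtain ⟨b, hb, hD⟩ := hex {i} {j, k} di djk k (by clear * - hij hik hjk; grind [Finset.mem_symmDiff])
      have : b = i ∨ b = j ∨ b = k := by clear * - hb; grind [Finset.mem_symmDiff]
      rcases this with rfl | rfl | rfl
      · exact absurd (by convert hD using 1; clear * - hij hik hjk; ext x; grind [Finset.mem_symmDiff]) dk
      · convert hD using 1; clear * - hij hik hjk; ext x; grind [Finset.mem_symmDiff]
      · exact absurd (by convert hD using 1; clear * - hij hik hjk; ext x; grind [Finset.mem_symmDiff]) dik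
    have lijk : lowS U {i, j, k} := by
      rcases le_total i k with h | h
      · exact ⟨k, by simp, hk, by simp [h, hjk.le]⟩
      · exact ⟨i, by simp, hi, by simp [h, hjk.le.trans h]⟩
    have h1 := hl {i} {i, j, k} j k hjk.ne (by clear * - hij hik hjk; ext x; grind [Finset.mem_symmDiff]) di dijk (by
      intro h
      have : symmDiff ({i} : Finset (Fin n)) {k} = {i, k} := by
        clear * - hij hik hjk; ext x; grind [Finset.mem_symmDiff]
      rw [this] at h; exact dik h.2) (lw1 i hi) lijk
    have h2 := hs {j, k} {i, j, k} i (by clear * - hij hik hjk; ext x; grind [Finset.mem_symmDiff]) djk dijk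
      (lw2 j k hjk hk) lijk
    have := cR i j k hij hik hjk.ne di djk dijk dk dik
    linarith
  -- two pairs sharing an element
  have L3 : ∀ i j k, i ≠ j → i ≠ k → j ≠ k → lowS U {i, k} → lowS U {j, k} → D {i, k} → D {j, k} →
      ¬ (D {i} ∧ D {k}) → ¬ (D {j} ∧ D {k}) → ψ {i, k} = ψ {j, k} := by
    intro i j k hij hik hjk l1 l2 d1 d2 n1 n2
    by_cases dk : D {k}
    · have di : ¬ D {i} := fun h => n1 ⟨h, dk⟩
      have dj : ¬ D {j} := fun h => n2 ⟨h, dk⟩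
      by_cases hk : k ∈ U
      · have a := LT k i hik.symm hk (by rwa [Finset.pair_comm]) dk (by rwa [Finset.pair_comm]) di
        have b := LT k j hjk.symm hk (by rwa [Finset.pair_comm]) dk (by rwa [Finset.pair_comm]) dj
        rw [Finset.pair_comm i, Finset.pair_comm j, ← a, ← b]
      have hi : i ∈ U := by
        obtain ⟨m, hm, hU, -⟩ := l1
        rcases (by simpa using hm : m = i ∨ m = k) with rfl | rfl
        · exact hU
        · exact absurd hU hk
      have hj : j ∈ U := by
        obtain ⟨m, hm, hU, -⟩ := l2
        rcases (by simpa using hm : m = j ∨ m = k) with rfl | rfl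
        · exact hU
        · exact absurd hU hk
      by_cases dijk : D {i, j, k}
      · have dij : D {i, j} := by
          obtain ⟨b, hb, hD⟩ := hex {i, j, k} ∅ dijk h0 k (by clear * - hij hik hjk; grind [Finset.mem_symmDiff])
          have : b = i ∨ b = j ∨ b = k := by clear * - hb; grind [Finset.mem_symmDiff]
          rcases this with rfl | rfl | rfl
          · exact absurd (by convert hD using 1; clear * - hij hik hjk; ext x; grind [Finset.mem_symmDiff]) dj
          · exact absurd (by convert hD using 1; clear * - hij hik hjk; ext x; grind [Finset.mem_symmDiff]) di
          · convert hD using 1; clear * - hij hik hjk; ext x; grind [Finset.mem_symmDiff]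
        have a := LP k j i hjk.symm hik.symm hij.symm (by rwa [Finset.pair_comm])
          (by rwa [Finset.pair_comm]) di (by rwa [Finset.pair_comm]) (lw2' j i hj hi)
        have b := LP k i j hik.symm hjk.symm hij (by rwa [Finset.pair_comm])
          dij dj (by rwa [Finset.pair_comm]) (lw2' i j hi hj)
        rw [Finset.pair_comm i k, Finset.pair_comm j k, a, b, Finset.pair_comm]
      · refine hl _ _ i j hij (by clear * - hij hik hjk; ext x; grind [Finset.mem_symmDiff]) d1 d2 ?_ l1 l2
        intro h
        have : symmDiff ({i, k} : Finset (Fin n)) {j} = {i, j, k} := by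
          clear * - hij hik hjk; ext x; grind [Finset.mem_symmDiff]
        rw [this] at h; exact dijk h.2
    · exact LP i j k hij hik hjk d1 d2 dk l1 l2
  -- disjoint pairs
  have L4 : ∀ i j k l, i < j → k < l → j < l → i ≠ k → i ≠ l → j ≠ k → j ∈ U → l ∈ U →
      D {i, j} → D {k, l} → ¬ (D {i} ∧ D {j}) → ¬ (D {k} ∧ D {l}) → ψ {i, j} = ψ {k, l} := by
    intro i j k l hij hkl hjl hik hil hjk hj hl' d1 d2 n1 n2
    by_cases dl : D {l}
    · rw [← L2 l i j hij hl' hj dl d1 n1, ← L2 l k l hkl hl' hl' dl d2 n2]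
    by_cases dj : D {j}
    · rw [← L2 j i j hij hj hj dj d1 n1, ← L2 j k l hkl hj hl' dj d2 n2]
    by_cases djl : D {j, l}
    · have a := L3 i l j hil hij.ne hjl.ne' (lw2 i j hij hj)
        (lw2' l j hl' hj) d1 (by rwa [Finset.pair_comm]) n1 (fun h => dl h.1)
      have b := L3 k j l hjk.symm hkl.ne hjl.ne (lw2 k l hkl hl') (lw2 j l hjl hl') d2 djl n2
        (fun h => dl h.2)
      rw [a, b, Finset.pair_comm]
    by_cases dil : D {i, l}
    · have a := L3 j l i hjl.ne hij.ne' hil.symm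
        (by rw [Finset.pair_comm]; exact lw2 i j hij hj)
        (by rw [Finset.pair_comm]; exact lw2 i l (hij.trans hjl) hl')
        (by rwa [Finset.pair_comm])
        (by rwa [Finset.pair_comm]) (fun h => dj h.1) (fun h => dl h.1)
      have b := L3 k i l hik.symm hkl.ne hil (lw2 k l hkl hl')
        (lw2 i l (hij.trans hjl) hl') d2 dil n2
        (fun h => dl h.2)
      rw [Finset.pair_comm i j, a, b, Finset.pair_comm]
    have dijl : ¬ D {i, j, l} := by
      intro d
      obtain ⟨b, hb, hD⟩ := hex ∅ {i, j, l} h0 d l (by clear * - hij hkl hjl hik hil hjk; grind [Finset.mem_symmDiff])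
      have : b = i ∨ b = j ∨ b = l := by clear * - hb; grind [Finset.mem_symmDiff]
      rcases this with rfl | rfl | rfl
      · exact absurd (by convert hD using 1; clear * - hij hkl hjl hik hil hjk; ext x; grind [Finset.mem_symmDiff]) dil
      · exact absurd (by convert hD using 1; clear * - hij hkl hjl hik hil hjk; ext x; grind [Finset.mem_symmDiff]) djl
      · exact absurd (by convert hD using 1; clear * - hij hkl hjl hik hil hjk; ext x; grind [Finset.mem_symmDiff]) dl
    have djkl : ¬ D {j, k, l} := by
      intro d
      obtain ⟨b, hb, hD⟩ := hex {j, k, l} ∅ d h0 k (by clear * - hij hkl hjl hik hil hjk; grind [Finset.mem_symmDiff])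
      have : b = j ∨ b = k ∨ b = l := by clear * - hb; grind [Finset.mem_symmDiff]
      rcases this with rfl | rfl | rfl
      · exact absurd (by convert hD using 1; clear * - hij hkl hjl hik hil hjk; ext x; grind [Finset.mem_symmDiff]) dl
      · exact absurd (by convert hD using 1; clear * - hij hkl hjl hik hil hjk; ext x; grind [Finset.mem_symmDiff]) djl
      · exact absurd (by convert hD using 1; clear * - hij hkl hjl hik hil hjk; ext x; grind [Finset.mem_symmDiff]) dj
    have dall : D {i, j, k, l} := by
      obtain ⟨b, hb, hD⟩ := hex {i, j} {k, l} d1 d2 l (by clear * - hij hkl hjl hik hil hjk; grind [Finset.mem_symmDiff])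
      have : b = i ∨ b = j ∨ b = k ∨ b = l := by clear * - hb; grind [Finset.mem_symmDiff]
      rcases this with rfl | rfl | rfl | rfl
      · exact absurd (by convert hD using 1; clear * - hij hkl hjl hik hil hjk; ext x; grind [Finset.mem_symmDiff]) djl
      · exact absurd (by convert hD using 1; clear * - hij hkl hjl hik hil hjk; ext x; grind [Finset.mem_symmDiff]) dil
      · convert hD using 1; clear * - hij hkl hjl hik hil hjk; ext x; grind [Finset.mem_symmDiff]
      · exact absurd (by convert hD using 1; clear * - hij hkl hjl hik hil hjk; ext x; grind [Finset.mem_symmDiff]) dijl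
    have lall : lowS U {i, j, k, l} := ⟨l, by simp, hl', by simp [hjl.le, hkl.le, (hij.trans hjl).le]⟩
    have a := hl {i, j} {i, j, k, l} k l hkl.ne (by clear * - hij hkl hjl hik hil hjk; ext x; grind [Finset.mem_symmDiff]) d1 dall (by
      intro h
      have : symmDiff ({i, j} : Finset (Fin n)) {l} = {i, j, l} := by
        clear * - hij hkl hjl hik hil hjk; ext x; grind [Finset.mem_symmDiff]
      rw [this] at h; exact dijl h.2) (lw2 i j hij hj) lall
    have b := hl {k, l} {i, j, k, l} i j hij.ne (by clear * - hij hkl hjl hik hil hjk; ext x; grind [Finset.mem_symmDiff]) d2 dall (by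
      intro h
      have : symmDiff ({k, l} : Finset (Fin n)) {j} = {j, k, l} := by
        clear * - hij hkl hjl hik hil hjk; ext x; grind [Finset.mem_symmDiff]
      rw [this] at h; exact djkl h.2) (lw2 k l hkl hl') lall
    rw [a, b]
  -- assemble
  have L5 : ∀ i j k l, i < j → k < l → j ∈ U → l ∈ U →
      D {i, j} → D {k, l} → ¬ (D {i} ∧ D {j}) → ¬ (D {k} ∧ D {l}) → ψ {i, j} = ψ {k, l} := by
    intro i j k l hij hkl hj hl' d1 d2 n1 n2
    by_cases e1 : j = l
    · subst e1
      by_cases e2 : i = k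
      · rw [e2]
      · exact L3 i k j e2 hij.ne hkl.ne (lw2 _ _ hij hj) (lw2 _ _ hkl hj) d1 d2 n1 n2
    by_cases e2 : i = k
    · subst e2
      have := L3 j l i e1 hij.ne' hkl.ne' (by rw [Finset.pair_comm]; exact lw2 _ _ hij hj)
        (by rw [Finset.pair_comm]; exact lw2 _ _ hkl hl') (by rwa [Finset.pair_comm])
        (by rwa [Finset.pair_comm]) (fun h => n1 h.symm) (fun h => n2 h.symm)
      rw [Finset.pair_comm i j, this, Finset.pair_comm]
    by_cases e3 : i = l
    · subst e3
      have := L3 j k i (hkl.trans hij).ne' hij.ne' hkl.ne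
        (by rw [Finset.pair_comm]; exact lw2 _ _ hij hj)
        (lw2 _ _ hkl hl') (by rwa [Finset.pair_comm])
        d2 (fun h => n1 h.symm) n2
      rw [Finset.pair_comm i j, this]
    by_cases e4 : j = k
    · subst e4
      have := L3 i l j (hij.trans hkl).ne hij.ne hkl.ne'
        (lw2 _ _ hij hj)
        (by rw [Finset.pair_comm]; exact lw2 _ _ hkl hl') d1 (by rwa [Finset.pair_comm])
        n1 (fun h => n2 h.symm)
      rw [this, Finset.pair_comm]
    rcases lt_or_gt_of_ne e1 with h | h
    · exact L4 i j k l hij hkl h e2 e3 e4 hj hl' d1 d2 n1 n2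
    · exact (L4 k l i j hkl hij h (Ne.symm e2) (Ne.symm e4) (Ne.symm e3) hl' hj d2 d1 n2 n1).symm
  rcases hc with ⟨i, hi, di, rfl⟩ | ⟨i, j, hij, hj, d1, n1, rfl⟩ <;>
  rcases hc' with ⟨k, hk, dk, rfl⟩ | ⟨k, l, hkl, hl', d2, n2, rfl⟩
  · exact L1 i k hi hk di dk
  · exact L2 i k l hkl hi hl' di d2 n2
  · exact (L2 k i j hij hk hj dk d1 n1).symm
  · exact L5 i j k l hij hkl hj hl' d1 d2 n1 n2

theorem lowS_lt {n : ℕ} {A S : Finset (Fin n)} (h : lowS A S) :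
    toColex (symmDiff A S) < toColex A := by
  obtain ⟨m, hm, hA, hx⟩ := h
  rw [Finset.Colex.toColex_lt_toColex]
  refine ⟨?_, ?_⟩
  · intro h
    have : m ∈ symmDiff A S := by rw [h]; exact hA
    simp [Finset.mem_symmDiff, hm, hA] at this
  · intro a ha ha'
    refine ⟨m, hA, by simp [Finset.mem_symmDiff, hm, hA], hx a ?_⟩
    simp only [Finset.mem_symmDiff] at ha
    tauto

theorem lt_lowS {n : ℕ} {A S : Finset (Fin n)} (h : toColex (symmDiff A S) < toColex A) :
    lowS A S := by
  rw [Finset.Colex.toColex_lt_toColex_iff_max'_mem] at h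
  obtain ⟨hne, h⟩ := h
  have e : symmDiff (symmDiff A S) A = S := by
    rw [symmDiff_comm A S, symmDiff_symmDiff_cancel_right]
  have hS : S.Nonempty := by
    rw [Finset.nonempty_iff_ne_empty]; rintro rfl; exact hne (by simp)
  refine ⟨S.max' hS, S.max'_mem hS, ?_, fun x hx => S.le_max' x hx⟩
  convert h using 1
  congr 1
  exact e.symm

theorem exists_potential {n : ℕ} (D : Finset (Finset (Fin n)))
    (hex : ∀ X ∈ D, ∀ Y ∈ D, ∀ a ∈ symmDiff X Y, ∃ b ∈ symmDiff X Y, symmDiff X {a, b} ∈ D)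
    (e : Finset (Fin n) → Finset (Fin n) → ℤ)
    (anti : ∀ X Y i, symmDiff X Y = {i} → X ∈ D → Y ∈ D → e Y X = - e X Y)
    (cS : ∀ A i j, i ≠ j → A ∈ D → symmDiff A {i} ∈ D → symmDiff A {j} ∈ D →
      symmDiff A {i, j} ∈ D →
      e A (symmDiff A {i}) + e (symmDiff A {i}) (symmDiff A {i, j}) =
      e A (symmDiff A {j}) + e (symmDiff A {j}) (symmDiff A {i, j}))
    (cT : ∀ A i j, i ≠ j → A ∈ D → symmDiff A {i} ∈ D → symmDiff A {i, j} ∈ D →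
      symmDiff A {j} ∉ D →
      e A (symmDiff A {i}) + e (symmDiff A {i}) (symmDiff A {i, j}) = 0)
    (cR : ∀ A i j k, i ≠ j → i ≠ k → j ≠ k → A ∈ D → symmDiff A {i} ∈ D →
      symmDiff A {j, k} ∈ D → symmDiff A {i, j, k} ∈ D →
      symmDiff A {k} ∉ D → symmDiff A {i, k} ∉ D →
      e A (symmDiff A {i}) = e (symmDiff A {j, k}) (symmDiff A {i, j, k})) :
    ∃ φ : Finset (Fin n) → ℤ,
      (∀ X Y i, symmDiff X Y = {i} → X ∈ D → Y ∈ D → e X Y = φ Y - φ X) ∧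
      (∀ X Y i j, i ≠ j → symmDiff X Y = {i, j} → X ∈ D → Y ∈ D →
        ¬ (symmDiff X {i} ∈ D ∧ symmDiff X {j} ∈ D) → φ X = φ Y) := by
  have key : ∀ s : Finset (Finset (Fin n)), s ⊆ D →
      (∀ x ∈ s, ∀ y ∈ D, toColex y ≤ toColex x → y ∈ s) →
      ∃ φ : Finset (Fin n) → ℤ,
      (∀ X Y i, symmDiff X Y = {i} → X ∈ s → Y ∈ s → e X Y = φ Y - φ X) ∧
      (∀ X Y i j, i ≠ j → symmDiff X Y = {i, j} → X ∈ s → Y ∈ s →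
        ¬ (symmDiff X {i} ∈ D ∧ symmDiff X {j} ∈ D) → φ X = φ Y) := by
    intro s
    induction s using Finset.induction_on_max_value (fun x : Finset (Fin n) => toColex x) with
    | empty => intro _ _; exact ⟨0, by simp, by simp⟩
    | insert A s hAs hmax ih =>
      intro hsub hlow
      have hlt : ∀ x ∈ s, toColex x < toColex A := by
        intro x hx
        refine lt_of_le_of_ne (hmax x hx) ?_
        intro h
        have : x = A := toColex.injective h
        exact hAs (this ▸ hx)
      have hAD : A ∈ D := hsub (Finset.mem_insert_self _ _)
      have hsD : s ⊆ D := fun x hx => hsub (Finset.mem_insert_of_mem hx)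
      obtain ⟨φ, h1, h2⟩ := ih hsD (by
        intro x hx y hy hyx
        rcases Finset.mem_insert.1 (hlow x (Finset.mem_insert_of_mem hx) y hy hyx) with rfl | h
        · exact absurd hyx (not_le.2 (hlt x hx))
        · exact h)
      have hmem : ∀ S, symmDiff A S ∈ D → lowS A S → symmDiff A S ∈ s := by
        intro S hS hl
        have hl := lowS_lt hl
        rcases Finset.mem_insert.1 (hlow A (Finset.mem_insert_self _ _) _ hS hl.le) with h | h
        · rw [h] at hl; exact absurd hl (lt_irrefl _)
        · exact h
      have sd : ∀ S T : Finset (Fin n), symmDiff (symmDiff A S) (symmDiff A T) = symmDiff S T := by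
        intro S T
        rw [symmDiff_symmDiff_symmDiff_comm]; simp
      have sd0 : symmDiff A ∅ = A := symmDiff_bot A
      have huniq := isVal_unique A (fun S => symmDiff A S ∈ D) (fun S => φ (symmDiff A S))
        (fun S T => e (symmDiff A S) (symmDiff A T)) (by simpa [sd0] using hAD)
        (by
          intro X Y hX hY a ha
          obtain ⟨b, hb, hb'⟩ := hex _ hX _ hY a (by rwa [sd])
          exact ⟨b, by rwa [sd] at hb, by rwa [symmDiff_assoc] at hb'⟩)
        (by
          intro X Y i hXY hX hY lX lY
          exact h1 _ _ i (by rwa [sd]) (hmem _ hX lX) (hmem _ hY lY))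
        (by
          intro X Y i j hij hXY hX hY hn lX lY
          exact h2 _ _ i j hij (by rwa [sd]) (hmem _ hX lX) (hmem _ hY lY)
            (by simpa only [symmDiff_assoc] using hn))
        (by
          intro i j hij hi hj hd
          have := cS A i j hij hAD hi hj hd
          simpa [sd0] using this)
        (by
          intro i j hij hi hj hd
          have := cT A i j hij hAD hi hj hd
          simpa [sd0] using this)
        (by
          intro i j hij hi hj hd
          have e1 : symmDiff (symmDiff A {i}) {i} = A := by simp
          have e2 : symmDiff (symmDiff A {i}) {i, j} = symmDiff A {j} := by
            rw [symmDiff_assoc]; congr 1; clear * - hij; ext x; grind [Finset.mem_symmDiff]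
          have e3 : symmDiff (symmDiff A {i}) {j} = symmDiff A {i, j} := by
            rw [symmDiff_assoc]; congr 1; clear * - hij; ext x; grind [Finset.mem_symmDiff]
          have := cT (symmDiff A {i}) i j hij hi (by rwa [e1]) (by rwa [e2]) (by rwa [e3])
          rw [e1, e2] at this
          have h3 := anti A (symmDiff A {i}) i (by simp) hAD hi
          simp only [sd0]
          linarith)
        (by
          intro i j k hij hik hjk a1 a2 a3 a4 a5
          have := cR A i j k hij hik hjk hAD a1 a2 a3 a4 a5
          simpa [sd0] using this)
      obtain ⟨c, hc⟩ : ∃ c, ∀ c', IsVal A (fun S => symmDiff A S ∈ D) (fun S => φ (symmDiff A S))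
          (fun S T => e (symmDiff A S) (symmDiff A T)) c' → c' = c := by
        by_cases h : ∃ c, IsVal A (fun S => symmDiff A S ∈ D) (fun S => φ (symmDiff A S))
          (fun S T => e (symmDiff A S) (symmDiff A T)) c
        · obtain ⟨c, hc⟩ := h
          exact ⟨c, fun c' h' => huniq c' c h' hc⟩
        · exact ⟨0, fun c' h' => absurd ⟨c', h'⟩ h⟩
      have hB : ∀ B S, symmDiff A B = S → B = symmDiff A S := by
        rintro B S rfl; simp
      have low' : ∀ B ∈ s, ∀ S, symmDiff A B = S → lowS A S := by
        intro B hBs S hS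
        apply lt_lowS
        rw [← hB B S hS]; exact hlt B hBs
      have new1 : ∀ B i, symmDiff A B = {i} → B ∈ s → e A B = φ B - c := by
        intro B i hi hBs
        have hl := low' B hBs _ hi
        have hb := hB B _ hi
        have hiA : i ∈ A := by
          obtain ⟨m, hm, hm', -⟩ := hl
          rw [Finset.mem_singleton] at hm; exact hm ▸ hm'
        have := hc (φ B - e A B) (Or.inl ⟨i, hiA, by simp only [← hb]; exact hsD hBs, by
          simp only [← hb, sd0]⟩)
        linarith
      have new2 : ∀ B i j, i ≠ j → symmDiff A B = {i, j} → B ∈ s →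
          ¬ (symmDiff A {i} ∈ D ∧ symmDiff A {j} ∈ D) → φ B = c := by
        have aux : ∀ B i j, i < j → symmDiff A B = {i, j} → B ∈ s →
          ¬ (symmDiff A {i} ∈ D ∧ symmDiff A {j} ∈ D) → φ B = c := by
          intro B i j hij hi hBs hn
          have hl := low' B hBs _ hi
          have hb := hB B _ hi
          have hjA : j ∈ A := by
            obtain ⟨m, hm, hm', hx⟩ := hl
            have h1 := hx j (by simp)
            rcases (by simpa using hm : m = i ∨ m = j) with rfl | rfl
            · exact absurd h1 (not_le.2 hij)
            · exact hm'
          exact hc (φ B) (Or.inr ⟨i, j, hij, hjA, by simp only [← hb]; exact hsD hBs, hn, by simp only [← hb]⟩)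
        intro B i j hij hi hBs hn
        rcases lt_or_gt_of_ne hij with h | h
        · exact aux B i j h hi hBs hn
        · exact aux B j i h (by rw [hi, Finset.pair_comm]) hBs (fun h => hn h.symm)
      have hne : ∀ B ∈ s, B ≠ A := by rintro B hB' rfl; exact hAs hB'
      refine ⟨Function.update φ A c, ?_, ?_⟩
      · intro X Y i hXY hX hY
        rcases Finset.mem_insert.1 hX with rfl | hX' <;> rcases Finset.mem_insert.1 hY with rfl | hY'
        · rw [symmDiff_self] at hXY
          exact absurd hXY.symm (Finset.singleton_ne_empty i)
        · rw [Function.update_self, Function.update_of_ne (hne Y hY')]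
          exact new1 Y i hXY hY'
        · rw [Function.update_self, Function.update_of_ne (hne X hX')]
          have := new1 X i (by rw [symmDiff_comm]; exact hXY) hX'
          have h3 := anti X Y i hXY (hsD hX') hAD
          linarith
        · rw [Function.update_of_ne (hne X hX'), Function.update_of_ne (hne Y hY')]
          exact h1 X Y i hXY hX' hY'
      · intro X Y i j hij hXY hX hY hn
        rcases Finset.mem_insert.1 hX with rfl | hX' <;> rcases Finset.mem_insert.1 hY with rfl | hY'
        · rfl
        · rw [Function.update_self, Function.update_of_ne (hne Y hY')]
          exact (new2 Y i j hij hXY hY' hn).symm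
        · rw [Function.update_self, Function.update_of_ne (hne X hX')]
          refine new2 X i j hij (by rw [symmDiff_comm]; exact hXY) hX' ?_
          have hYX : Y = symmDiff X {i, j} := by rw [← hXY]; simp
          have e1 : symmDiff Y {i} = symmDiff X {j} := by
            rw [hYX, symmDiff_assoc]; congr 1; clear * - hij; ext x; grind [Finset.mem_symmDiff]
          have e2 : symmDiff Y {j} = symmDiff X {i} := by
            rw [hYX, symmDiff_assoc]; congr 1; clear * - hij; ext x; grind [Finset.mem_symmDiff]
          rw [e1, e2]
          exact fun h => hn h.symm
        · rw [Function.update_of_ne (hne X hX'), Function.update_of_ne (hne Y hY')]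
          exact h2 X Y i j hij hXY hX' hY' hn
  exact key D (Finset.Subset.refl D) (fun _ _ y hy _ => hy)

/-- The admissible `n`-set encoded by the set `X` of starred coordinates. -/
def bas {n : ℕ} (X : Finset (Fin n)) : Finset (JJ n) :=
  Finset.univ.filter (fun x => x.2 = true ↔ x.1 ∈ X)

theorem mem_bas {n : ℕ} {X : Finset (Fin n)} {x : JJ n} :
    x ∈ bas X ↔ (x.2 = true ↔ x.1 ∈ X) := by simp [bas]

theorem bas_inj {n : ℕ} {X Y : Finset (Fin n)} (h : bas X = bas Y) : X = Y := by
  ext i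
  have := congrArg (fun S => ((i, true) : JJ n) ∈ S) h
  simpa [mem_bas] using this

theorem bas_eq_image {n : ℕ} (X : Finset (Fin n)) :
    bas X = Finset.univ.image (fun i : Fin n => ((i, decide (i ∈ X)) : JJ n)) := by
  ext ⟨i, b⟩
  cases b <;> simp [mem_bas]

theorem bas_card {n : ℕ} (X : Finset (Fin n)) : (bas X).card = n := by
  rw [bas_eq_image, Finset.card_image_of_injective _ (by intro a b h; simpa using congrArg Prod.fst h)]
  simp

theorem exists_bas {n : ℕ} {A : Finset (JJ n)} (h : AdmissibleSet A) (hc : A.card = n) :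
    ∃ X, A = bas X := by
  refine ⟨Finset.univ.filter (fun i => ((i, true) : JJ n) ∈ A), ?_⟩
  apply Finset.eq_of_subset_of_card_le
  · rintro ⟨i, b⟩ hx
    have := h _ hx
    cases b <;> simp [mem_bas, starJ] at * <;> assumption
  · rw [bas_card, hc]

theorem mem_symmDiff_bas {n : ℕ} {X Y : Finset (Fin n)} {x : JJ n} :
    x ∈ symmDiff (bas X) (bas Y) ↔ x.1 ∈ symmDiff X Y := by
  simp only [Finset.mem_symmDiff, mem_bas]
  tauto

theorem height_bas {n : ℕ} (F A : Finset (Fin n)) :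
    heightF (bas F) (bas A) = (symmDiff F A).card := by
  have h : bas A ∩ bas F =
      (symmDiff F A)ᶜ.image (fun i : Fin n => ((i, decide (i ∈ A)) : JJ n)) := by
    ext ⟨i, b⟩
    cases b <;> simp [mem_bas, Finset.mem_symmDiff] <;> tauto
  rw [heightF, h, Finset.card_image_of_injective _ (by intro a b h; simpa using congrArg Prod.fst h),
    Finset.card_compl, Fintype.card_fin]
  have : (symmDiff F A).card ≤ n := by simpa using Finset.card_le_univ (symmDiff F A)
  omega

theorem sdiff_bas {n : ℕ} (G H A : Finset (Fin n)) :
    (bas G \ (bas H ∪ bas A)).card = (symmDiff G H ∩ symmDiff G A).card := by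
  have h : bas G \ (bas H ∪ bas A) =
      (symmDiff G H ∩ symmDiff G A).image (fun i : Fin n => ((i, decide (i ∈ G)) : JJ n)) := by
    ext ⟨i, b⟩
    cases b <;> simp [mem_bas, Finset.mem_symmDiff] <;> tauto
  rw [h, Finset.card_image_of_injective _ (by intro a b h; simpa using congrArg Prod.fst h)]

theorem eSet_bas {n : ℕ} (X : Finset (Fin n)) (i : Fin n) :
    eSet (bas X) i = if i ∈ X then -1 else 1 := by
  rw [bas_eq_image, eSet, Finset.sum_image (by intro a _ b _ h; simpa using congrArg Prod.fst h)]
  simp [eVec]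

theorem eSet_bas_inj {n : ℕ} {X Y : Finset (Fin n)} (h : eSet (bas X) = eSet (bas Y)) : X = Y := by
  ext i
  have := congrFun h i
  rw [eSet_bas, eSet_bas] at this
  by_cases h1 : i ∈ X <;> by_cases h2 : i ∈ Y <;> simp [h1, h2] at * <;> norm_num at this

/-- Every weight vector, twisted by `A`, comes from a linear functional. -/
theorem exists_func {n : ℕ} (A : Finset (Fin n)) (d : Fin n → ℝ) :
    ∃ (L : (Fin n → ℝ) →ₗ[ℝ] ℝ) (c : ℝ), ∀ S,
      L (eSet (bas (symmDiff A S))) = c - ∑ f ∈ S, d f := by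
  refine ⟨∑ f, ((if f ∈ A then -1 else 1) * (d f / 2)) • LinearMap.proj f, ∑ f, d f / 2, ?_⟩
  intro S
  rw [← Finset.sum_filter_add_sum_filter_not Finset.univ (fun f => f ∈ S) (fun f => d f / 2)]
  simp only [LinearMap.sum_apply, LinearMap.smul_apply, LinearMap.proj_apply, eSet_bas, smul_eq_mul]
  rw [← Finset.sum_filter_add_sum_filter_not Finset.univ (fun f => f ∈ S)]
  have e1 : ∑ x ∈ Finset.univ.filter (fun f => f ∈ S), ((if x ∈ A then (-1 : ℝ) else 1) * (d x / 2)) *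
      (if x ∈ symmDiff A S then (-1 : ℝ) else 1) = ∑ x ∈ S, - (d x / 2) := by
    rw [Finset.filter_univ_mem]
    refine Finset.sum_congr rfl fun x hx => ?_
    by_cases h : x ∈ A <;> simp [h, hx, Finset.mem_symmDiff]
  have e2 : ∑ x ∈ Finset.univ.filter (fun f => f ∉ S), ((if x ∈ A then (-1 : ℝ) else 1) * (d x / 2)) *
      (if x ∈ symmDiff A S then (-1 : ℝ) else 1) =
      ∑ x ∈ Finset.univ.filter (fun f => f ∉ S), d x / 2 := by
    refine Finset.sum_congr rfl fun x hx => ?_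
    rw [Finset.mem_filter] at hx
    by_cases h : x ∈ A <;> simp [h, hx, Finset.mem_symmDiff]
  rw [e1, e2, Finset.filter_univ_mem]
  have : ∑ f ∈ S, d f = ∑ f ∈ S, d f / 2 + ∑ f ∈ S, d f / 2 := by
    rw [← Finset.sum_add_distrib]; exact Finset.sum_congr rfl fun x _ => by ring
  rw [this, Finset.sum_neg_distrib]
  ring

theorem func_weights {n : ℕ} (L : (Fin n → ℝ) →ₗ[ℝ] ℝ) (A : Finset (Fin n)) :
    ∃ d : Fin n → ℝ, ∀ S, L (eSet (bas (symmDiff A S))) = L (eSet (bas A)) - ∑ f ∈ S, d f := by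
  refine ⟨fun f => L (Pi.single f (if f ∈ A then -2 else 2)), fun S => ?_⟩
  rw [← map_sum, ← map_sub]
  congr 1
  ext i
  simp only [Pi.sub_apply, Finset.sum_apply, eSet_bas, Pi.single_apply]
  rw [Finset.sum_ite_eq]
  by_cases h1 : i ∈ A <;> by_cases h2 : i ∈ S <;> simp [h1, h2, Finset.mem_symmDiff] <;> norm_num

/-- The symmetric exchange axiom follows from the Maximality Property. -/
theorem exchange {n : ℕ} {ℬ : Finset (Finset (JJ n))} (hM : IsLagrangianMatroid ℬ)
    (X Y : Finset (Fin n)) (hX : bas X ∈ ℬ) (hY : bas Y ∈ ℬ) (a : Fin n) (ha : a ∈ symmDiff X Y) :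
    ∃ b ∈ symmDiff X Y, bas (symmDiff X {a, b}) ∈ ℬ := by
  set T : Finset (Fin n) := insert a (symmDiff X Y)ᶜ with hT
  set Z : Finset (Fin n) := symmDiff X {a} with hZ
  let f : Fin n → ℕ := fun i => if i ∈ T then 1 else 0
  let σ : Equiv.Perm (Fin n) := Tuple.sort f
  have hmono : Monotone (f ∘ σ) := Tuple.monotone_sort f
  have hσ : ∀ i j, i ∈ T → j ∉ T → σ.symm j < σ.symm i := by
    intro i j hi hj
    by_contra hcon
    have := hmono (not_lt.1 hcon)
    simp [f, hi, hj] at this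
  let w : Equiv.Perm (JJ n) :=
    { toFun := fun x => (σ x.1, xor x.2 (decide (σ x.1 ∈ Z)))
      invFun := fun x => (σ.symm x.1, xor x.2 (decide (x.1 ∈ Z)))
      left_inv := by rintro ⟨i, b⟩; simp
      right_inv := by rintro ⟨i, b⟩; simp }
  have hw : ∀ x, w.symm x = (σ.symm x.1, xor x.2 (decide (x.1 ∈ Z))) := fun x => rfl
  have hadm : AdmissiblePerm w := by
    rintro ⟨i, b⟩
    simp [w, starJ]
  obtain ⟨M, hMB, hmax⟩ := hM.2 w hadm
  obtain ⟨Q, rfl⟩ := exists_bas (hM.1 M hMB).1 (hM.1 M hMB).2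
  -- positive elements are those of `bas Z`
  have hpos : ∀ x : JJ n, 0 < ordJ (w.symm x) ↔ x ∈ bas Z := by
    rintro ⟨i, b⟩
    rw [hw, mem_bas]
    simp only [ordJ]
    by_cases h : i ∈ Z <;> cases b <;> simp [h] <;> omega
  have hord : ∀ x : JJ n, x ∈ bas Z → ordJ (w.symm x) = (σ.symm x.1 : ℤ) + 1 := by
    intro x hx
    have := (hpos x).2 hx
    rw [hw] at this ⊢
    simp only [ordJ] at *
    split_ifs at * with h
    · omega
    · rfl
  have hZX : symmDiff Z X = {a} := by rw [hZ, symmDiff_comm X]; simp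
  have hZT : ∀ i ∈ T, (i ∈ Z ↔ i ∈ Y) := by
    intro i hi
    simp only [hT, hZ, Finset.mem_insert, Finset.mem_compl, Finset.mem_symmDiff, Finset.mem_singleton] at *
    by_cases h : i = a
    · subst h; tauto
    · tauto
  -- `Q` agrees with `Z` on `T`
  have hQT : ∀ i ∈ T, (i ∈ Q ↔ i ∈ Z) := by
    obtain ⟨g, hg, hle⟩ := hmax (bas Y) hY
    let P : Finset (JJ n) := T.image (fun i => ((i, decide (i ∈ Y)) : JJ n))
    have hPZ : ∀ x, x ∈ P ↔ x ∈ bas Z ∧ x.1 ∈ T := by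
      rintro ⟨i, b⟩
      by_cases hi : i ∈ T
      · have := hZT i hi
        cases b <;> simp [P, mem_bas, hi, this]
      · simp [P, hi]
    have hPY : ∀ x ∈ P, x ∈ bas Y := by
      intro x hx
      obtain ⟨i, hi, rfl⟩ := Finset.mem_image.1 hx
      simp [mem_bas]
    have hmaps : ∀ x ∈ P, g x ∈ P := by
      intro x hx
      have h1 := hle x (hPY x hx)
      rw [leW, hord x ((hPZ x).1 hx).1] at h1
      have h2 : g x ∈ bas Z := (hpos _).1 (by omega)
      refine (hPZ _).2 ⟨h2, ?_⟩
      by_contra hcon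
      have := hσ x.1 (g x).1 ((hPZ x).1 hx).2 hcon
      rw [hord _ h2] at h1
      have : (σ.symm (g x).1 : ℕ) < σ.symm x.1 := this
      omega
    have himg : P.image g = P := by
      apply Finset.eq_of_subset_of_card_le
      · intro y hy
        obtain ⟨x, hx, rfl⟩ := Finset.mem_image.1 hy
        exact hmaps x hx
      · refine (Finset.card_image_of_injOn (s := P) (f := g) ?_).ge
        intro x hx y hy hxy
        exact hg.injOn (by simpa using hPY x hx) (by simpa using hPY y hy) hxy
    intro i hi
    have hp : ((i, decide (i ∈ Y)) : JJ n) ∈ P := Finset.mem_image_of_mem _ hi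
    rw [← himg] at hp
    obtain ⟨x, hx, hxe⟩ := Finset.mem_image.1 hp
    have : g x ∈ bas Q := by simpa using hg.mapsTo (by simpa using hPY x hx)
    rw [hxe, mem_bas] at this
    rw [hZT i hi, ← this]; simp
  -- `Q` differs from `Z` in at most one place
  have hQZ : (symmDiff Q Z).card ≤ 1 := by
    obtain ⟨g, hg, hle⟩ := hmax (bas X) hX
    have hmaps : ∀ x ∈ bas X ∩ bas Z, g x ∈ bas Q ∩ bas Z := by
      intro x hx
      rw [Finset.mem_inter] at hx ⊢
      refine ⟨by simpa using hg.mapsTo (by simpa using hx.1), ?_⟩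
      have h1 := hle x hx.1
      have h2 := (hpos x).2 hx.2
      rw [leW] at h1
      exact (hpos _).1 (by omega)
    have hcard := Finset.card_le_card_of_injOn g hmaps (by
      intro x hx y hy hxy
      exact hg.injOn (by simp at hx; simpa using hx.1) (by simp at hy; simpa using hy.1) hxy)
    have h1 := height_bas Z X
    have h2 := height_bas Z Q
    rw [hZX, Finset.card_singleton, heightF] at h1
    rw [heightF] at h2
    rw [symmDiff_comm]
    omega
  have hsub : symmDiff Q Z ⊆ symmDiff X Y := by
    intro i hi
    by_contra hcon
    have := hQT i (Finset.mem_insert_of_mem (Finset.mem_compl.2 hcon))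
    simp only [Finset.mem_symmDiff] at hi
    tauto
  have haQ : a ∉ symmDiff Q Z := by
    have := hQT a (by simp [hT])
    simp only [Finset.mem_symmDiff]
    tauto
  rcases Finset.eq_empty_or_nonempty (symmDiff Q Z) with h | ⟨b, hb⟩
  · refine ⟨a, ha, ?_⟩
    have : Q = Z := symmDiff_eq_bot.1 h
    rw [this] at hMB
    simpa [hZ] using hMB
  · refine ⟨b, hsub hb, ?_⟩
    have hs : symmDiff Q Z = {b} := by
      apply Finset.eq_singleton_iff_unique_mem.2 ⟨hb, fun y hy => ?_⟩
      exact Finset.card_le_one.1 hQZ y hy b hb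
    have hab : a ≠ b := by rintro rfl; exact haQ hb
    have : Q = symmDiff X {a, b} := by
      have e1 : Q = symmDiff Z {b} := by
        rw [← hs, symmDiff_comm Q, symmDiff_symmDiff_cancel_left]
      rw [e1, hZ, symmDiff_assoc]
      congr 1
      clear * - hab
      ext x; grind [Finset.mem_symmDiff]
    rwa [← this]

theorem isEdge_of_weights {n : ℕ} {ℬ : Finset (Finset (JJ n))}
    (hall : ∀ C ∈ ℬ, ∃ X, C = bas X) (A S₀ : Finset (Fin n)) (hS : S₀ ≠ ∅)
    (hA : bas A ∈ ℬ) (hB : bas (symmDiff A S₀) ∈ ℬ) (d : Fin n → ℝ) (h0 : ∑ f ∈ S₀, d f = 0)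
    (hd : ∀ S, bas (symmDiff A S) ∈ ℬ → S ≠ ∅ → S ≠ S₀ → 0 < ∑ f ∈ S, d f) :
    IsEdge ℬ (bas A) (bas (symmDiff A S₀)) := by
  obtain ⟨L, c, hL⟩ := exists_func A d
  have hLA : L (eSet (bas A)) = c := by
    have := hL ∅
    have e : symmDiff A ∅ = A := symmDiff_bot A
    simpa [e] using this
  refine ⟨hA, hB, ?_, L, ?_, ?_⟩
  · intro h
    have := bas_inj h
    exact hS (symmDiff_eq_left.1 this.symm)
  · rw [hLA, hL, h0, sub_zero]
  · intro C hC hCA hCB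
    obtain ⟨X, rfl⟩ := hall C hC
    have hX : X = symmDiff A (symmDiff A X) := by simp
    rw [hX, hL, hLA]
    have := hd (symmDiff A X) (by rwa [← hX])
      (by intro h; apply hCA; have : A = X := symmDiff_eq_bot.1 h
          rw [this])
      (by intro h; apply hCB; rw [← h, ← hX])
    linarith

theorem isEdge_symm {n : ℕ} {ℬ : Finset (Finset (JJ n))} {A B : Finset (JJ n)}
    (h : IsEdge ℬ A B) : IsEdge ℬ B A := by
  obtain ⟨hA, hB, hne, L, h1, h2⟩ := h
  exact ⟨hB, hA, hne.symm, L, h1.symm, fun C hC h3 h4 => h1 ▸ h2 C hC h4 h3⟩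

/-- Weights vanishing on `Q` and equal to one elsewhere. -/
theorem w1_sum {n : ℕ} (Q S : Finset (Fin n)) :
    (S ⊆ Q ∧ ∑ f ∈ S, (if f ∈ Q then (0 : ℝ) else 1) = 0) ∨
    (¬ S ⊆ Q ∧ 0 < ∑ f ∈ S, (if f ∈ Q then (0 : ℝ) else 1)) := by
  by_cases h : S ⊆ Q
  · exact Or.inl ⟨h, Finset.sum_eq_zero fun x hx => by simp [h hx]⟩
  · refine Or.inr ⟨h, ?_⟩
    obtain ⟨x, hx, hxQ⟩ := Finset.not_subset.1 h
    exact Finset.sum_pos' (fun y _ => by split_ifs <;> simp) ⟨x, hx, by simp [hxQ]⟩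

theorem w2_sum {n : ℕ} (R S : Finset (Fin n)) (j k : Fin n) (hjk : j ≠ k) (hj : j ∉ R) (hk : k ∉ R) :
    ∑ f ∈ S, (if f = k then (-1 : ℝ) else if f = j then 1 else if f ∈ R then 0 else 2) =
      2 * ((S \ (insert j (insert k R))).card : ℝ) + (if j ∈ S then 1 else 0) -
        (if k ∈ S then 1 else 0) := by
  have : ∀ f : Fin n, (if f = k then (-1 : ℝ) else if f = j then 1 else if f ∈ R then 0 else 2) =
      (if f ∈ insert j (insert k R) then 0 else 2) + (if f = j then 1 else 0)
        - (if f = k then 1 else 0) := by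
    intro f
    by_cases h1 : f = k
    · subst h1; simp [hjk.symm]
    by_cases h2 : f = j
    · subst h2; simp [hjk]
    by_cases h3 : f ∈ R <;> simp [h1, h2, h3]
  rw [Finset.sum_congr rfl (fun f _ => this f), Finset.sum_sub_distrib, Finset.sum_add_distrib,
    Finset.sum_ite_eq', Finset.sum_ite_eq']
  congr 2
  rw [Finset.sum_ite, Finset.sum_const_zero, zero_add, Finset.sum_const, nsmul_eq_mul, mul_comm,
    Finset.filter_notMem_eq_sdiff]

theorem w2_cases {n : ℕ} (R S : Finset (Fin n)) (j k : Fin n) (hjk : j ≠ k) (hj : j ∉ R) (hk : k ∉ R) :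
    (S ⊆ insert j (insert k R) ∧ k ∈ S ∧ j ∉ S) ∨
    (S ⊆ insert j (insert k R) ∧ (j ∈ S ↔ k ∈ S) ∧
      ∑ f ∈ S, (if f = k then (-1 : ℝ) else if f = j then 1 else if f ∈ R then 0 else 2) = 0) ∨
    (¬ (S ⊆ insert j (insert k R) ∧ (j ∈ S ↔ k ∈ S)) ∧
      0 < ∑ f ∈ S, (if f = k then (-1 : ℝ) else if f = j then 1 else if f ∈ R then 0 else 2)) := by
  rw [w2_sum R S j k hjk hj hk]
  by_cases h : S ⊆ insert j (insert k R)
  · have h0 : (S \ (insert j (insert k R))).card = 0 := by simpa using h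
    rw [h0]
    by_cases h1 : j ∈ S <;> by_cases h2 : k ∈ S <;> simp [h, h1, h2]
  · have h0 : 0 < (S \ (insert j (insert k R))).card := by
      rw [Finset.card_pos]; simpa [Finset.sdiff_nonempty] using h
    have h1 : (1 : ℝ) ≤ (S \ (insert j (insert k R))).card := by exact_mod_cast h0
    refine Or.inr (Or.inr ⟨fun h' => h h'.1, ?_⟩)
    split_ifs <;> linarith

theorem edge_short {n : ℕ} {ℬ : Finset (Finset (JJ n))}
    (hall : ∀ C ∈ ℬ, ∃ X, C = bas X) (A : Finset (Fin n)) (i : Fin n)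
    (hA : bas A ∈ ℬ) (hB : bas (symmDiff A {i}) ∈ ℬ) :
    IsEdge ℬ (bas A) (bas (symmDiff A {i})) := by
  refine isEdge_of_weights hall A {i} (by simp) hA hB (fun f => if f ∈ ({i} : Finset (Fin n)) then 0 else 1)
    (by simp) ?_
  intro S _ h1 h2
  rcases w1_sum {i} S with h | h
  · exact absurd (Finset.subset_singleton_iff.1 h.1) (by tauto)
  · exact h.2

theorem edge_long {n : ℕ} {ℬ : Finset (Finset (JJ n))}
    (hall : ∀ C ∈ ℬ, ∃ X, C = bas X) (A : Finset (Fin n)) (j k : Fin n) (hjk : j ≠ k)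
    (hA : bas A ∈ ℬ) (hB : bas (symmDiff A {j, k}) ∈ ℬ) (hk : bas (symmDiff A {k}) ∉ ℬ) :
    IsEdge ℬ (bas A) (bas (symmDiff A {j, k})) := by
  refine isEdge_of_weights hall A {j, k} (by simp) hA hB
    (fun f => if f = k then (-1 : ℝ) else if f = j then 1 else if f ∈ (∅ : Finset (Fin n)) then 0 else 2)
    ?_ ?_
  · rw [Finset.sum_pair hjk]; simp [hjk]
  intro S hS h1 h2
  have hk' : S ≠ {k} := by rintro rfl; exact hk hS
  rcases w2_cases ∅ S j k hjk (by simp) (by simp) with h | h | h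
  · exfalso; apply hk'
    clear * - h; ext x; have := @h.1 x; grind
  · exfalso
    by_cases hj : j ∈ S
    · apply h2; have := h.2.1.1 hj; ext x; have := @h.1 x; clear hall; grind
    · apply h1; have : k ∉ S := fun hk => hj (h.2.1.2 hk)
      ext x; have := @h.1 x; clear hall; grind
  · exact h.2

/-- Every edge is short or long. -/
theorem edge_classify {n : ℕ} {ℬ : Finset (Finset (JJ n))} (hM : IsLagrangianMatroid ℬ)
    (X Y : Finset (Fin n)) (h : IsEdge ℬ (bas X) (bas Y)) :
    (∃ i, symmDiff X Y = {i}) ∨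
    (∃ i j, i ≠ j ∧ symmDiff X Y = {i, j} ∧
      ¬ (bas (symmDiff X {i}) ∈ ℬ ∧ bas (symmDiff X {j}) ∈ ℬ)) := by
  obtain ⟨hX, hY, hne, L, hL1, hL2⟩ := h
  obtain ⟨d, hd⟩ := func_weights L X
  have hXY : X ≠ Y := fun h => hne (by rw [h])
  set S₀ := symmDiff X Y with hS
  have hYX : Y = symmDiff X S₀ := by simp [hS]
  have h0 : ∑ f ∈ S₀, d f = 0 := by
    have := hd S₀
    rw [← hYX] at this
    linarith
  have hpos : ∀ S, bas (symmDiff X S) ∈ ℬ → S ≠ ∅ → S ≠ S₀ → 0 < ∑ f ∈ S, d f := by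
    intro S hSB h1 h2
    have := hL2 _ hSB
      (fun h => h1 (symmDiff_eq_left.1 (bas_inj h)))
      (fun h => h2 (by have := bas_inj h; rw [hS, ← this]; simp))
    rw [hd] at this
    linarith
  have hne0 : S₀.Nonempty := by
    rw [hS, Finset.nonempty_iff_ne_empty]
    exact fun h => hXY (symmDiff_eq_bot.1 h)
  have hcard : S₀.card ≤ 2 := by
    by_contra hc
    push Not at hc
    have hp : ∀ a b, ({a, b} : Finset (Fin n)) ≠ S₀ := by
      intro a b h
      have := Finset.card_le_two (a := a) (b := b)
      rw [h] at this; omega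
    have hsum : ∀ a b, ∑ f ∈ ({a, b} : Finset (Fin n)), d f = if a = b then d a else d a + d b := by
      intro a b
      split_ifs with h
      · subst h; simp
      · exact Finset.sum_pair h
    obtain ⟨a, ha, hmax⟩ := Finset.exists_max_image S₀ (fun f => |d f|) hne0
    rcases le_or_gt (d a) 0 with hda | hda
    · obtain ⟨b, hb, hbB⟩ := exchange hM X Y hX hY a ha
      have h1 := hpos {a, b} hbB (by simp) (hp a b)
      rw [hsum] at h1
      have h2 := hmax b hb
      rw [abs_of_nonpos hda] at h2
      have h3 := le_abs_self (d b)
      split_ifs at h1 <;> linarith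
    · obtain ⟨b, hb, hbB⟩ := exchange hM Y X hY hX a (by rwa [symmDiff_comm])
      rw [symmDiff_comm] at hb
      have hsub : ({a, b} : Finset (Fin n)) ⊆ S₀ := by
        intro x hx
        rcases (by simpa using hx : x = a ∨ x = b) with rfl | rfl <;> assumption
      have he : symmDiff Y {a, b} = symmDiff X (S₀ \ {a, b}) := by
        rw [hYX, symmDiff_assoc]
        congr 1
        clear * - hsub
        ext x
        have := @hsub x
        simp only [Finset.mem_symmDiff, Finset.mem_sdiff]
        tauto
      have h1 := hpos (S₀ \ {a, b}) (he ▸ hbB)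
        (by
          intro h
          have := Finset.card_sdiff_add_card_eq_card hsub
          have h5 := Finset.card_le_two (a := a) (b := b)
          rw [h, Finset.card_empty] at this
          omega)
        (by
          intro h
          have : a ∈ S₀ \ {a, b} := by rw [h]; exact ha
          simp at this)
      have h4 := Finset.sum_sdiff (f := d) hsub
      rw [h0, hsum] at h4
      have h2 := hmax b hb
      rw [abs_of_pos hda] at h2
      have h3 := neg_abs_le (d b)
      split_ifs at h4 <;> linarith
  have hc1 := hne0.card_pos
  rcases (by omega : S₀.card = 1 ∨ S₀.card = 2) with h | h
  · exact Or.inl (Finset.card_eq_one.1 h)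
  · right
    obtain ⟨i, j, hij, he⟩ := Finset.card_eq_two.1 h
    refine ⟨i, j, hij, he, ?_⟩
    rintro ⟨hi, hj⟩
    have h1 := hpos {i} hi (by simp) (by rw [he]; intro h; have : j ∈ ({i} : Finset (Fin n)) := by rw [h]; simp
                                         simp at this; exact hij this.symm)
    have h2 := hpos {j} hj (by simp) (by rw [he]; intro h; have : i ∈ ({j} : Finset (Fin n)) := by rw [h]; simp
                                         simp at this; exact hij this)
    rw [he, Finset.sum_pair hij] at h0
    simp at h1 h2
    linarith

theorem finrank_two {n : ℕ} (S : Set (Fin n → ℝ)) (p u v : Fin n → ℝ) (hp : p ∈ S)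
    (hu : p + u ∈ S) (hv : p + v ∈ S) (hS : ∀ x ∈ S, ∃ a b : ℝ, x = p + (a • u + b • v))
    (i j : Fin n) (h1 : u i ≠ 0) (h2 : u j = 0) (h3 : v j ≠ 0) :
    Module.finrank ℝ (vectorSpan ℝ (convexHull ℝ S)) = 2 := by
  have e1 : vectorSpan ℝ (convexHull ℝ S) = vectorSpan ℝ S := by
    rw [← direction_affineSpan, affineSpan_convexHull, direction_affineSpan]
  have e2 : vectorSpan ℝ S = Submodule.span ℝ (Set.range ![u, v]) := by
    apply le_antisymm
    · rw [vectorSpan_eq_span_vsub_set_right ℝ hp, Submodule.span_le]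
      rintro _ ⟨x, hx, rfl⟩
      obtain ⟨a, b, rfl⟩ := hS x hx
      have : p + (a • u + b • v) -ᵥ p = a • u + b • v := by simp
      simp only [this]
      exact Submodule.add_mem _ (Submodule.smul_mem _ _ (Submodule.subset_span ⟨0, rfl⟩))
        (Submodule.smul_mem _ _ (Submodule.subset_span ⟨1, rfl⟩))
    · rw [Submodule.span_le]
      rintro _ ⟨k, rfl⟩
      fin_cases k
      · simpa using vsub_mem_vectorSpan ℝ hu hp
      · simpa using vsub_mem_vectorSpan ℝ hv hp
  rw [e1, e2, finrank_span_eq_card]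
  · simp
  · rw [LinearIndependent.pair_iff]
    intro s t hst
    have hj := congrFun hst j
    have hi := congrFun hst i
    simp only [Pi.add_apply, Pi.smul_apply, smul_eq_mul, Pi.zero_apply, h2, mul_zero, zero_add] at hi hj
    have ht : t = 0 := by rcases mul_eq_zero.1 hj with h | h; exacts [h, absurd h h3]
    subst ht
    rw [zero_mul, add_zero] at hi
    rcases mul_eq_zero.1 hi with h | h
    exacts [⟨h, rfl⟩, absurd h h1]

/-- The exposed face spanned by the maximisers of a functional. -/
theorem exposed_face {n : ℕ} {ℬ : Finset (Finset (JJ n))} (L : (Fin n → ℝ) →ₗ[ℝ] ℝ) (c : ℝ)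
    (T : Set (Finset (JJ n))) (hT : T ⊆ ↑ℬ) (h1 : ∀ B ∈ T, L (eSet B) = c)
    (h2 : ∀ B ∈ ℬ, B ∉ T → L (eSet B) < c) :
    IsExposed ℝ (matroidPolytope ℬ) (convexHull ℝ (eSet '' T)) ∧
    ∀ B ∈ ℬ, eSet B ∈ convexHull ℝ (eSet '' T) → B ∈ T := by
  have hK : convexHull ℝ (eSet '' T) ⊆ {x | L x = c} := by
    apply convexHull_min
    · rintro _ ⟨B, hB, rfl⟩; exact h1 B hB
    · exact convex_hyperplane L.isLinear c
  have hP : matroidPolytope ℬ ⊆ {x | L x < c} ∪ convexHull ℝ (eSet '' T) := by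
    apply convexHull_min
    · rintro _ ⟨B, hB, rfl⟩
      by_cases hBT : B ∈ T
      · exact Or.inr (subset_convexHull ℝ _ ⟨B, hBT, rfl⟩)
      · exact Or.inl (h2 B hB hBT)
    · intro x hx y hy a b ha hb hab
      have hle : ∀ z ∈ {x | L x < c} ∪ convexHull ℝ (eSet '' T), L z ≤ c := by
        rintro z (hz | hz)
        · exact le_of_lt hz
        · exact le_of_eq (hK hz)
      have hLL : L (a • x + b • y) = a * L x + b * L y := by simp
      have hb' : b = 1 - a := by linarith
      by_cases ha0 : a = 0
      · have : b = 1 := by linarith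
        subst ha0; subst this; simpa using hy
      by_cases hb0 : b = 0
      · have : a = 1 := by linarith
        subst hb0; subst this; simpa using hx
      have ha1 : 0 < a := lt_of_le_of_ne ha (Ne.symm ha0)
      have hb1 : 0 < b := lt_of_le_of_ne hb (Ne.symm hb0)
      have lx := hle x hx
      have ly := hle y hy
      rcases hx with hx | hx
      · left
        simp only [Set.mem_setOf_eq] at hx ⊢
        rw [hLL]
        have := mul_lt_mul_of_pos_left hx ha1
        have := mul_le_mul_of_nonneg_left ly hb
        have : a * c + b * c = c := by rw [← add_mul, hab, one_mul]
        linarith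
      · rcases hy with hy | hy
        · left
          simp only [Set.mem_setOf_eq] at hy ⊢
          rw [hLL]
          have := mul_lt_mul_of_pos_left hy hb1
          have := mul_le_mul_of_nonneg_left lx ha
          have : a * c + b * c = c := by rw [← add_mul, hab, one_mul]
          linarith
        · right
          exact convex_convexHull ℝ _ hx hy ha hb hab
  have hsub : convexHull ℝ (eSet '' T) ⊆ matroidPolytope ℬ :=
    convexHull_mono (Set.image_mono hT)
  refine ⟨?_, ?_⟩
  · rintro ⟨z, hz⟩
    refine ⟨LinearMap.toContinuousLinearMap L, ?_⟩
    ext x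
    simp only [LinearMap.coe_toContinuousLinearMap', Set.mem_setOf_eq]
    constructor
    · intro hx
      refine ⟨hsub hx, fun y hy => ?_⟩
      have hx' : L x = c := hK hx
      rw [hx']
      rcases hP hy with h | h
      · exact le_of_lt h
      · exact le_of_eq (hK h)
    · rintro ⟨hx, hmax⟩
      have h3 := hmax z (hsub hz)
      have hz' : L z = c := hK hz
      rcases hP hx with h | h
      · simp only [Set.mem_setOf_eq] at h
        linarith
      · exact h
  · intro B hB hBc
    by_contra hcon
    have h3 := h2 B hB hcon
    have : L (eSet B) = c := hK hBc
    linarith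

theorem sub_pair {n : ℕ} {S : Finset (Fin n)} {i j : Fin n} (h : S ⊆ {i, j}) :
    S = ∅ ∨ S = {i} ∨ S = {j} ∨ S = {i, j} := by
  have h' : ∀ x ∈ S, x = i ∨ x = j := fun x hx => by simpa using h hx
  by_cases hi : i ∈ S <;> by_cases hj : j ∈ S
  · refine Or.inr (Or.inr (Or.inr ?_)); ext x; grind
  · refine Or.inr (Or.inl ?_); ext x; grind
  · refine Or.inr (Or.inr (Or.inl ?_)); ext x; grind
  · refine Or.inl ?_; ext x; grind

theorem eSet_bas_symmDiff {n : ℕ} (A S : Finset (Fin n)) (f : Fin n) :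
    eSet (bas (symmDiff A S)) f = eSet (bas A) f +
      (if f ∈ S then (1 : ℝ) else 0) * (if f ∈ A then 2 else -2) := by
  rw [eSet_bas, eSet_bas]
  by_cases h1 : f ∈ A <;> by_cases h2 : f ∈ S <;> simp [Finset.mem_symmDiff, h1, h2] <;> norm_num

/-- The signed sum of a polytope orientation around a face given by weights. -/
theorem face_cycle_sum {n : ℕ} {ℬ : Finset (Finset (JJ n))}
    (hall : ∀ C ∈ ℬ, ∃ X, C = bas X) {ε : Finset (JJ n) → Finset (JJ n) → ℤ}
    (hε : IsPolytopeOrientation ℬ ε) (A : Finset (Fin n)) (m : ℕ) (hm : 3 ≤ m)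
    (t : ℕ → Finset (Fin n)) (t0 : t 0 = ∅)
    (tinj : ∀ i < m, ∀ j < m, t i = t j → i = j)
    (tB : ∀ i < m, bas (symmDiff A (t i)) ∈ ℬ)
    (d : Fin n → ℝ) (hd0 : ∀ i < m, ∑ f ∈ t i, d f = 0)
    (hd : ∀ S, bas (symmDiff A S) ∈ ℬ → (∀ i < m, t i ≠ S) → 0 < ∑ f ∈ S, d f)
    (hE : ∀ i < m, IsEdge ℬ (bas (symmDiff A (t i))) (bas (symmDiff A (t ((i + 1) % m)))))
    (x y : Fin n) (hx : x ∈ t 1) (hy : y ∉ t 1) (hy' : y ∈ t (m - 1))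
    (hspan : ∀ i < m, ∃ a b : ℝ, ∀ f, (if f ∈ t i then (1 : ℝ) else 0) =
      a * (if f ∈ t 1 then 1 else 0) + b * (if f ∈ t (m - 1) then 1 else 0)) :
    ∑ i ∈ Finset.range m,
      ε (bas (symmDiff A (t i))) (bas (symmDiff A (t ((i + 1) % m)))) = 0 := by
  obtain ⟨L, c, hL⟩ := exists_func A d
  let T : Set (Finset (JJ n)) := {B | ∃ i < m, B = bas (symmDiff A (t i))}
  have hTB : T ⊆ ↑ℬ := by
    rintro _ ⟨i, hi, rfl⟩
    exact tB i hi
  have hf := exposed_face (ℬ := ℬ) L c T hTB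
    (by rintro _ ⟨i, hi, rfl⟩; rw [hL, hd0 i hi, sub_zero])
    (by
      intro B hB hBT
      obtain ⟨X, rfl⟩ := hall B hB
      have hX : X = symmDiff A (symmDiff A X) := by simp
      have := hd (symmDiff A X) (by rwa [← hX])
        (fun i hi h => hBT ⟨i, hi, by rw [h, ← hX]⟩)
      rw [hX, hL]
      linarith)
  have sd0 : symmDiff A ∅ = A := symmDiff_bot A
  let p := eSet (bas A)
  have hmem : ∀ i < m, eSet (bas (symmDiff A (t i))) ∈ eSet '' T := fun i hi => ⟨_, ⟨i, hi, rfl⟩, rfl⟩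
  refine hε.2.2 (convexHull ℝ (eSet '' T)) m (fun i => bas (symmDiff A (t i)))
    ⟨⟨hf.1, ?_⟩, hm, ?_, ?_, hE⟩
  · apply finrank_two (eSet '' T) p (eSet (bas (symmDiff A (t 1))) - p)
      (eSet (bas (symmDiff A (t (m - 1)))) - p) _ _ _ _ x y
    · simp only [p, Pi.sub_apply, eSet_bas_symmDiff]
      split_ifs <;> simp
    · simp only [p, Pi.sub_apply, eSet_bas_symmDiff]
      simp [hy]
    · simp only [p, Pi.sub_apply, eSet_bas_symmDiff]
      split_ifs <;> simp
    · have := hmem 0 (by omega)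
      rwa [t0, sd0] at this
    · rw [add_sub_cancel]; exact hmem 1 (by omega)
    · rw [add_sub_cancel]; exact hmem (m - 1) (by omega)
    · rintro _ ⟨_, ⟨i, hi, rfl⟩, rfl⟩
      obtain ⟨a, b, hab⟩ := hspan i hi
      refine ⟨a, b, ?_⟩
      ext f
      simp only [p, Pi.add_apply, Pi.smul_apply, Pi.sub_apply, eSet_bas_symmDiff, smul_eq_mul]
      rw [hab f]
      ring
  · intro i hi
    exact ⟨tB i hi, subset_convexHull ℝ _ (hmem i hi)⟩
  · intro B hB hBF
    obtain ⟨i, hi, rfl⟩ := hf.2 B hB hBF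
    refine ⟨i, ⟨hi, rfl⟩, ?_⟩
    rintro k ⟨hk, hke⟩
    exact tinj k hk i hi (symmDiff_right_injective A (bas_inj hke))

theorem short_bas {n : ℕ} {ℬ : Finset (Finset (JJ n))} (hall : ∀ C ∈ ℬ, ∃ X, C = bas X)
    {X Y : Finset (Fin n)} {i : Fin n} (h : symmDiff X Y = {i}) (hX : bas X ∈ ℬ) (hY : bas Y ∈ ℬ) :
    IsShortEdge ℬ (bas X) (bas Y) := by
  have hYX : Y = symmDiff X {i} := by rw [← h]; simp
  refine ⟨?_, (i, false), ?_⟩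
  · rw [hYX]; exact edge_short hall X i hX (hYX ▸ hY)
  · ext ⟨a, b⟩
    rw [mem_symmDiff_bas, h]
    cases b <;> simp [starJ]

theorem not_short_bas {n : ℕ} {ℬ : Finset (Finset (JJ n))}
    {X Y : Finset (Fin n)} {i j : Fin n} (hij : i ≠ j) (h : symmDiff X Y = {i, j}) :
    ¬ IsShortEdge ℬ (bas X) (bas Y) := by
  rintro ⟨-, ⟨a, b⟩, h1⟩
  have hi : ((i, false) : JJ n) ∈ symmDiff (bas X) (bas Y) := by
    rw [mem_symmDiff_bas, h]; simp
  have hj : ((j, false) : JJ n) ∈ symmDiff (bas X) (bas Y) := by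
    rw [mem_symmDiff_bas, h]; simp
  rw [h1] at hi hj
  simp [starJ] at hi hj
  apply hij
  grind

theorem not_long_bas {n : ℕ} {ℬ : Finset (Finset (JJ n))}
    {X Y : Finset (Fin n)} {i : Fin n} (h : symmDiff X Y = {i}) :
    ¬ IsLongEdge ℬ (bas X) (bas Y) := by
  rintro ⟨-, a, b, hab, hab', h1⟩
  have ha : a ∈ symmDiff (bas X) (bas Y) := by rw [h1]; simp
  have hb : b ∈ symmDiff (bas X) (bas Y) := by rw [h1]; simp
  rw [mem_symmDiff_bas, h, Finset.mem_singleton] at ha hb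
  obtain ⟨a1, a2⟩ := a
  obtain ⟨b1, b2⟩ := b
  cases a2 <;> cases b2 <;> simp_all [starJ]

theorem long_bas {n : ℕ} {ℬ : Finset (Finset (JJ n))}
    {X Y : Finset (Fin n)} {i j : Fin n} (hij : i ≠ j) (h : symmDiff X Y = {i, j})
    (hE : IsEdge ℬ (bas X) (bas Y)) : IsLongEdge ℬ (bas X) (bas Y) := by
  refine ⟨hE, (i, false), (j, false), by simpa using hij, by simp [starJ], ?_⟩
  ext ⟨a, b⟩
  rw [mem_symmDiff_bas, h]
  cases b <;> simp [starJ]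

/-- The potential of a polytope orientation. -/
theorem polytope_potential {n : ℕ} {ℬ : Finset (Finset (JJ n))} (hM : IsLagrangianMatroid ℬ)
    (hall : ∀ C ∈ ℬ, ∃ X, C = bas X) {ε : Finset (JJ n) → Finset (JJ n) → ℤ}
    (hε : IsPolytopeOrientation ℬ ε) :
    ∃ φ : Finset (Fin n) → ℤ,
      (∀ X Y i, symmDiff X Y = {i} → bas X ∈ ℬ → bas Y ∈ ℬ → ε (bas X) (bas Y) = φ Y - φ X) ∧
      (∀ X Y i j, i ≠ j → symmDiff X Y = {i, j} → bas X ∈ ℬ → bas Y ∈ ℬ →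
        ¬ (bas (symmDiff X {i}) ∈ ℬ ∧ bas (symmDiff X {j}) ∈ ℬ) → φ X = φ Y) := by
  have anti : ∀ X Y i, symmDiff X Y = {i} → bas X ∈ ℬ → bas Y ∈ ℬ →
      ε (bas Y) (bas X) = - ε (bas X) (bas Y) := fun X Y i h hX hY =>
    (hε.1 _ _ (short_bas hall h hX hY)).2
  have zero : ∀ X Y i j, i ≠ j → symmDiff X Y = {i, j} → ε (bas X) (bas Y) = 0 :=
    fun X Y i j hij h => hε.2.1 _ _ (not_short_bas hij h)
  have cS : ∀ A i j, i ≠ j → bas A ∈ ℬ → bas (symmDiff A {i}) ∈ ℬ → bas (symmDiff A {j}) ∈ ℬ →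
      bas (symmDiff A {i, j}) ∈ ℬ →
      ε (bas A) (bas (symmDiff A {i})) + ε (bas (symmDiff A {i})) (bas (symmDiff A {i, j})) =
      ε (bas A) (bas (symmDiff A {j})) + ε (bas (symmDiff A {j})) (bas (symmDiff A {i, j})) := by
    intro A i j hij hA hi hj hk
    have sd0 : symmDiff A ∅ = A := symmDiff_bot A
    have d1 : symmDiff (symmDiff A {i}) (symmDiff A {i, j}) = {j} := by
      clear * - hij; ext x; grind [Finset.mem_symmDiff]
    have d2 : symmDiff (symmDiff A {j}) (symmDiff A {i, j}) = {i} := by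
      clear * - hij; ext x; grind [Finset.mem_symmDiff]
    have d3 : symmDiff A (symmDiff A {j}) = {j} := by simp
    have d4 : symmDiff A (symmDiff A {i}) = {i} := by simp
    let t : ℕ → Finset (Fin n) := fun k => if k = 0 then ∅ else if k = 1 then {i} else
      if k = 2 then {i, j} else {j}
    have := face_cycle_sum hall hε A 4 (by norm_num) t (by simp [t])
      (by
        have n1 : ({i} : Finset (Fin n)) ≠ {j} := by simpa using hij
        have n2 : ({i} : Finset (Fin n)) ≠ {i, j} := by
          intro h; have := congrArg Finset.card h; rw [Finset.card_pair hij] at this; simp at this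
        have n3 : ({j} : Finset (Fin n)) ≠ {i, j} := by
          intro h; have := congrArg Finset.card h; rw [Finset.card_pair hij] at this; simp at this
        intro a ha b hb
        interval_cases a <;> interval_cases b <;> simp [t, n1, n2, n3, n1.symm, n2.symm, n3.symm, (Finset.insert_ne_empty _ _).symm])
      (by intro a ha; interval_cases a <;> simp [t, sd0] <;> assumption)
      (fun f => if f ∈ ({i, j} : Finset (Fin n)) then 0 else 1)
      (by intro a ha; interval_cases a <;> simp [t])
      (by
        intro S _ hS
        rcases w1_sum {i, j} S with h | h
        · exfalso
          have e0 := hS 0 (by norm_num)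
          have e1 := hS 1 (by norm_num)
          have e2 := hS 2 (by norm_num)
          have e3 := hS 3 (by norm_num)
          simp only [t] at e0 e1 e2 e3
          norm_num at e0 e1 e2 e3
          have := sub_pair h.1
          tauto
        · exact h.2)
      (by
        intro a ha
        interval_cases a <;> simp [t, sd0]
        · exact (short_bas hall d4 hA hi).1
        · exact (short_bas hall d1 hi hk).1
        · exact isEdge_symm (short_bas hall d2 hj hk).1
        · exact isEdge_symm (short_bas hall d3 hA hj).1)
      i j (by simp [t]) (by simpa [t] using hij.symm) (by simp [t])
      (by
        intro a ha
        interval_cases a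
        · exact ⟨0, 0, fun f => by simp [t]⟩
        · exact ⟨1, 0, fun f => by simp [t]⟩
        · refine ⟨1, 1, fun f => ?_⟩
          by_cases h1 : f = i
          · subst h1; simp [t, hij]
          · simp [t, h1]
        · exact ⟨0, 1, fun f => by simp [t]⟩)
    simp [Finset.sum_range_succ, t, sd0] at this
    have a1 := anti _ _ _ d2 hj hk
    have a2 := anti _ _ _ d3 hA hj
    linarith
  have cT : ∀ A i j, i ≠ j → bas A ∈ ℬ → bas (symmDiff A {i}) ∈ ℬ →
      bas (symmDiff A {i, j}) ∈ ℬ → bas (symmDiff A {j}) ∉ ℬ →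
      ε (bas A) (bas (symmDiff A {i})) + ε (bas (symmDiff A {i})) (bas (symmDiff A {i, j})) = 0 := by
    intro A i j hij hA hi hk hj
    have sd0 : symmDiff A ∅ = A := symmDiff_bot A
    have d1 : symmDiff (symmDiff A {i}) (symmDiff A {i, j}) = {j} := by
      clear * - hij; ext x; grind [Finset.mem_symmDiff]
    have d4 : symmDiff A (symmDiff A {i}) = {i} := by simp
    have d5 : symmDiff (symmDiff A {i, j}) A = {i, j} := by rw [symmDiff_comm]; simp
    let t : ℕ → Finset (Fin n) := fun k => if k = 0 then ∅ else if k = 1 then {i} else {i, j}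
    have := face_cycle_sum hall hε A 3 (by norm_num) t (by simp [t])
      (by
        have n2 : ({i} : Finset (Fin n)) ≠ {i, j} := by
          intro h; have := congrArg Finset.card h; rw [Finset.card_pair hij] at this; simp at this
        intro a ha b hb
        interval_cases a <;> interval_cases b <;> simp [t, n2, n2.symm, (Finset.insert_ne_empty _ _).symm])
      (by intro a ha; interval_cases a <;> simp [t, sd0] <;> assumption)
      (fun f => if f ∈ ({i, j} : Finset (Fin n)) then 0 else 1)
      (by intro a ha; interval_cases a <;> simp [t])
      (by
        intro S hSB hS
        rcases w1_sum {i, j} S with h | h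
        · exfalso
          have e0 := hS 0 (by norm_num)
          have e1 := hS 1 (by norm_num)
          have e2 := hS 2 (by norm_num)
          have e3 : S ≠ {j} := by rintro rfl; exact hj hSB
          simp only [t] at e0 e1 e2
          norm_num at e0 e1 e2
          have := sub_pair h.1
          tauto
        · exact h.2)
      (by
        intro a ha
        interval_cases a <;> simp [t, sd0]
        · exact (short_bas hall d4 hA hi).1
        · exact (short_bas hall d1 hi hk).1
        · exact isEdge_symm (edge_long hall A i j hij hA hk hj))
      i j (by simp [t]) (by simpa [t] using hij.symm) (by simp [t])
      (by
        intro a ha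
        interval_cases a
        · exact ⟨0, 0, fun f => by simp [t]⟩
        · exact ⟨1, 0, fun f => by simp [t]⟩
        · exact ⟨0, 1, fun f => by simp [t]⟩)
    simp [Finset.sum_range_succ, t, sd0] at this
    have a1 := zero _ _ _ _ hij d5
    linarith
  have cR : ∀ A i j k, i ≠ j → i ≠ k → j ≠ k → bas A ∈ ℬ → bas (symmDiff A {i}) ∈ ℬ →
      bas (symmDiff A {j, k}) ∈ ℬ → bas (symmDiff A {i, j, k}) ∈ ℬ → bas (symmDiff A {k}) ∉ ℬ →
      bas (symmDiff A {i, k}) ∉ ℬ →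
      ε (bas A) (bas (symmDiff A {i})) = ε (bas (symmDiff A {j, k})) (bas (symmDiff A {i, j, k})) := by
    intro A i j k hij hik hjk hA hi hh hf hk hc
    have sd0 : symmDiff A ∅ = A := symmDiff_bot A
    have d1 : symmDiff (symmDiff A {i}) (symmDiff A {i, j, k}) = {j, k} := by
      clear * - hij hik; ext x; grind [Finset.mem_symmDiff]
    have d2 : symmDiff (symmDiff A {j, k}) (symmDiff A {i, j, k}) = {i} := by
      clear * - hij hik; ext x; grind [Finset.mem_symmDiff]
    have d4 : symmDiff A (symmDiff A {i}) = {i} := by simp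
    have d5 : symmDiff (symmDiff A {j, k}) A = {j, k} := by rw [symmDiff_comm]; simp
    have d6 : symmDiff (symmDiff A {i}) {j, k} = symmDiff A {i, j, k} := by
      clear * - hij hik; ext x; grind [Finset.mem_symmDiff]
    have d7 : symmDiff (symmDiff A {i}) {k} = symmDiff A {i, k} := by
      clear * - hik; ext x; grind [Finset.mem_symmDiff]
    let t : ℕ → Finset (Fin n) := fun l => if l = 0 then ∅ else if l = 1 then {i} else
      if l = 2 then {i, j, k} else {j, k}
    have c2 : ({j, k} : Finset (Fin n)).card = 2 := Finset.card_pair hjk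
    have c3 : ({i, j, k} : Finset (Fin n)).card = 3 := Finset.card_eq_three.2 ⟨i, j, k, hij, hik, hjk, rfl⟩
    have := face_cycle_sum hall hε A 4 (by norm_num) t (by simp [t])
      (by
        have n1 : ({i} : Finset (Fin n)) ≠ {j, k} := by
          intro h; have := congrArg Finset.card h; rw [c2] at this; simp at this
        have n2 : ({i} : Finset (Fin n)) ≠ {i, j, k} := by
          intro h; have := congrArg Finset.card h; rw [c3] at this; simp at this
        have n3 : ({j, k} : Finset (Fin n)) ≠ {i, j, k} := by
          intro h; have := congrArg Finset.card h; rw [c2, c3] at this; simp at this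
        intro a ha b hb
        interval_cases a <;> interval_cases b <;> simp [t, n1, n2, n3, n1.symm, n2.symm, n3.symm, (Finset.insert_ne_empty _ _).symm])
      (by intro a ha; interval_cases a <;> simp [t, sd0] <;> assumption)
      (fun f => if f = k then (-1 : ℝ) else if f = j then 1 else if f ∈ ({i} : Finset (Fin n)) then 0 else 2)
      (by intro a ha; interval_cases a <;> simp only [t] <;> norm_num
          · simp [hij, hik]
          · rw [Finset.sum_insert (by simp [hij, hik]), Finset.sum_pair hjk]; simp [hij, hik, hjk]
          · rw [Finset.sum_pair hjk]; simp [hjk])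
      (by
        intro S hSB hS
        have m1 : S ≠ {k} := by rintro rfl; exact hk hSB
        have m2 : S ≠ {i, k} := by rintro rfl; exact hc hSB
        have e0 := hS 0 (by norm_num)
        have e1 := hS 1 (by norm_num)
        have e2 := hS 2 (by norm_num)
        have e3 := hS 3 (by norm_num)
        simp only [t] at e0 e1 e2 e3
        norm_num at e0 e1 e2 e3
        rcases w2_cases {i} S j k hjk (by simpa using hij.symm) (by simpa using hik.symm) with h | h | h
        · exfalso
          by_cases hiS : i ∈ S
          · apply m2; clear * - h hiS; ext x; have := @h.1 x; grind
          · apply m1; clear * - h hiS; ext x; have := @h.1 x; grind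
        · exfalso
          by_cases hiS : i ∈ S <;> by_cases hjS : j ∈ S
          · apply e2; have := h.2.1.1 hjS; clear * - h hiS hjS this; ext x; have := @h.1 x; grind
          · apply e1; have := fun q => hjS (h.2.1.2 q)
            clear * - h hiS hjS this; ext x; have := @h.1 x; grind
          · apply e3; have := h.2.1.1 hjS; clear * - h hiS hjS this; ext x; have := @h.1 x; grind
          · apply e0; have := fun q => hjS (h.2.1.2 q)
            clear * - h hiS hjS this; ext x; have := @h.1 x; grind
        · exact h.2)
      (by
        intro a ha
        interval_cases a <;> simp [t, sd0]
        · exact (short_bas hall d4 hA hi).1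
        · rw [← d6]
          exact edge_long hall _ j k hjk hi (d6 ▸ hf) (d7 ▸ hc)
        · exact isEdge_symm (short_bas hall d2 hh hf).1
        · exact isEdge_symm (edge_long hall A j k hjk hA hh hk))
      i j (by simp [t]) (by simpa [t] using hij.symm) (by simp [t])
      (by
        intro a ha
        interval_cases a
        · exact ⟨0, 0, fun f => by simp [t]⟩
        · exact ⟨1, 0, fun f => by simp [t]⟩
        · refine ⟨1, 1, fun f => ?_⟩
          by_cases h1 : f = i
          · subst h1; simp [t, hij, hik]
          · simp [t, h1]
        · exact ⟨0, 1, fun f => by simp [t]⟩)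
    simp [Finset.sum_range_succ, t, sd0] at this
    have a1 := anti _ _ _ d2 hh hf
    have a2 := zero _ _ _ _ hjk d5
    have a3 := zero _ _ _ _ hjk d1
    linarith
  obtain ⟨φ, h1, h2⟩ := exists_potential (Finset.univ.filter (fun X : Finset (Fin n) => bas X ∈ ℬ))
    (by simpa using fun X hX Y hY a ha => exchange hM X Y hX hY a ha)
    (fun X Y => ε (bas X) (bas Y))
    (by simpa using anti) (by simpa using cS) (by simpa using cT) (by simpa using cR)
  simp only [Finset.mem_filter, Finset.mem_univ, true_and] at h1 h2
  exact ⟨φ, h1, h2⟩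

theorem card_flip {n : ℕ} (F X : Finset (Fin n)) (i : Fin n) :
    (i ∈ symmDiff F X ∧ (symmDiff F X).card = (symmDiff F (symmDiff X {i})).card + 1) ∨
    (i ∉ symmDiff F X ∧ (symmDiff F (symmDiff X {i})).card = (symmDiff F X).card + 1) := by
  by_cases h : i ∈ symmDiff F X
  · left
    have e : symmDiff F (symmDiff X {i}) = (symmDiff F X).erase i := by
      ext x; grind [Finset.mem_symmDiff]
    rw [e, Finset.card_erase_of_mem h]
    have := Finset.card_pos.2 ⟨i, h⟩
    exact ⟨h, by omega⟩
  · right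
    have e : symmDiff F (symmDiff X {i}) = insert i (symmDiff F X) := by
      ext x; grind [Finset.mem_symmDiff]
    rw [e, Finset.card_insert_of_notMem h]
    exact ⟨h, rfl⟩

theorem symmDiff_pair {n : ℕ} (X : Finset (Fin n)) {i j : Fin n} (h : i ≠ j) :
    symmDiff X {i, j} = symmDiff (symmDiff X {i}) {j} := by
  ext x; grind [Finset.mem_symmDiff]

theorem eq_of_symmDiff {n : ℕ} {X Y S : Finset (Fin n)} (h : symmDiff X Y = S) : Y = symmDiff X S := by
  rw [← h]; simp

/-- From any basis one can descend along an edge towards the fundamental basis. -/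
theorem descend {n : ℕ} {ℬ : Finset (Finset (JJ n))} (hM : IsLagrangianMatroid ℬ)
    (hall : ∀ C ∈ ℬ, ∃ X, C = bas X) (F A : Finset (Fin n)) (hF : bas F ∈ ℬ) (hA : bas A ∈ ℬ)
    (hne : A ≠ F) : ∃ A', bas A' ∈ ℬ ∧ IsEdge ℬ (bas A) (bas A') ∧
      ((∃ a, symmDiff A A' = {a} ∧ (symmDiff F A).card = (symmDiff F A').card + 1) ∨
       (∃ a b, a ≠ b ∧ symmDiff A A' = {a, b} ∧ bas (symmDiff A {a}) ∉ ℬ ∧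
          (symmDiff F A).card = (symmDiff F A').card + 2)) := by
  have : (symmDiff A F).Nonempty := by
    rw [Finset.nonempty_iff_ne_empty]
    exact fun h => hne (symmDiff_eq_bot.1 h)
  obtain ⟨a, ha⟩ := this
  have ha' : a ∈ symmDiff F A := by rwa [symmDiff_comm]
  by_cases hB : bas (symmDiff A {a}) ∈ ℬ
  · refine ⟨symmDiff A {a}, hB, edge_short hall A a hA hB, Or.inl ⟨a, by simp, ?_⟩⟩
    rcases card_flip F A a with h | h
    · exact h.2
    · exact absurd ha' h.1
  · obtain ⟨b, hb, hAb⟩ := exchange hM A F hA hF a ha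
    have hab : a ≠ b := by
      rintro rfl
      apply hB
      simpa using hAb
    refine ⟨symmDiff A {a, b}, hAb, ?_, Or.inr ⟨a, b, hab, by simp, hB, ?_⟩⟩
    · have := edge_long hall A b a hab.symm hA (by rwa [Finset.pair_comm]) hB
      rwa [Finset.pair_comm]
    · rw [symmDiff_pair A hab]
      rw [symmDiff_comm] at hb
      rcases card_flip F A a with h | h
      · rcases card_flip F (symmDiff A {a}) b with h' | h'
        · omega
        · exfalso; apply h'.1
          clear * - hb hab
          grind [Finset.mem_symmDiff]
      · exact absurd ha' h.1

theorem parity {n : ℕ} {ℬ : Finset (Finset (JJ n))} (hM : IsLagrangianMatroid ℬ)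
    (hall : ∀ C ∈ ℬ, ∃ X, C = bas X) {ε : Finset (JJ n) → Finset (JJ n) → ℤ}
    (hε : IsPolytopeOrientation ℬ ε) (φ : Finset (Fin n) → ℤ)
    (h1 : ∀ X Y i, symmDiff X Y = {i} → bas X ∈ ℬ → bas Y ∈ ℬ → ε (bas X) (bas Y) = φ Y - φ X)
    (h2 : ∀ X Y i j, i ≠ j → symmDiff X Y = {i, j} → bas X ∈ ℬ → bas Y ∈ ℬ →
        ¬ (bas (symmDiff X {i}) ∈ ℬ ∧ bas (symmDiff X {j}) ∈ ℬ) → φ X = φ Y)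
    (F : Finset (Fin n)) (hF : bas F ∈ ℬ) :
    ∀ (k : ℕ) (A : Finset (Fin n)), bas A ∈ ℬ → (symmDiff F A).card = k →
      (((symmDiff F A).card : ℤ) - φ A + φ F) % 2 = 0 := by
  intro k
  induction k using Nat.strong_induction_on with
  | _ k ih =>
    intro A hA hk
    by_cases hne : A = F
    · subst hne; simp
    obtain ⟨A', hA', hE, ⟨a, hs, hc⟩ | ⟨a, b, hab, hs, hB, hc⟩⟩ := descend hM hall F A hF hA hne
    · have e1 := h1 A A' a hs hA hA'
      have e2 := (hε.1 _ _ (short_bas hall hs hA hA')).1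
      have e3 := ih _ (by omega) A' hA' rfl
      omega
    · have e1 := h2 A A' a b hab hs hA hA' (fun h => hB h.1)
      have e3 := ih _ (by omega) A' hA' rfl
      omega

/-- The sign attached to an even integer. -/
def sgn4 (z : ℤ) : ℤ := if z % 4 = 0 then 1 else -1

theorem sgn4_spec (z : ℤ) : (z % 4 = 0 ∧ sgn4 z = 1) ∨ (z % 4 ≠ 0 ∧ sgn4 z = -1) := by
  unfold sgn4; split_ifs with h <;> simp [h]

theorem sgn4_mul (a b c : ℤ) (k : ℕ) (ha : a % 2 = 0) (hb : b % 2 = 0) (hc : c % 2 = 0)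
    (h : a + c = b + 2 * k) : sgn4 a = sgn4 b * sgn4 c * (-1) ^ k := by
  rcases Nat.even_or_odd k with hk | hk
  · rw [hk.neg_one_pow]
    obtain ⟨r, hr⟩ := hk
    rcases sgn4_spec a with h1 | h1 <;> rcases sgn4_spec b with h2 | h2 <;>
      rcases sgn4_spec c with h3 | h3 <;> rw [h1.2, h2.2, h3.2] <;> norm_num <;> omega
  · rw [hk.neg_one_pow]
    obtain ⟨r, hr⟩ := hk
    rcases sgn4_spec a with h1 | h1 <;> rcases sgn4_spec b with h2 | h2 <;>
      rcases sgn4_spec c with h3 | h3 <;> rw [h1.2, h2.2, h3.2] <;> norm_num <;> omega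

/-- Integer core of the square axiom. -/
theorem square_core (hx hy hw ho px py pw po c : ℤ)
    (ex : (hx - px + c) % 2 = 0) (ey : (hy - py + c) % 2 = 0)
    (ew : (hw - pw + c) % 2 = 0) (eo : (ho - po + c) % 2 = 0)
    (d1 : py - px = 1 ∨ py - px = -1) (d2 : pw - px = 1 ∨ pw - px = -1)
    (d3 : po - py = 1 ∨ po - py = -1) (d4 : po - pw = 1 ∨ po - pw = -1)
    (k1 : hy - hx = 1 ∨ hy - hx = -1) (k2 : hw - hx = 1 ∨ hw - hx = -1)
    (k3 : ho - hx = (hy - hx) + (hw - hx))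
    (s1 : sgn4 (hy - py + c) = sgn4 (hw - pw + c))
    (s2 : sgn4 (hy - py + c) = sgn4 (ho - po + c))
    (s3 : sgn4 (hy - py + c) ≠ sgn4 (hx - px + c)) :
    (hy ≤ hx ∧ hw ≤ hx ∧ ho ≤ hx) ∨ (hx ≤ hy ∧ hx ≤ hw ∧ hx ≤ ho) := by
  by_contra hcon
  have hk : hy - hx = -(hw - hx) := by
    rcases k1 with k1 | k1 <;> rcases k2 with k2 | k2 <;> omega
  have hh : ho = hx := by omega
  subst hh
  have m1 : (ho - px + c) % 4 ≠ (ho - po + c) % 4 := by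
    intro h
    apply s3
    rw [s2]
    rcases sgn4_spec (ho - px + c) with h1 | h1 <;> rcases sgn4_spec (ho - po + c) with h2 | h2 <;>
      rw [h1.2, h2.2] <;> omega
  have m2 : (hy - py + c) % 4 = (hw - pw + c) % 4 := by
    rcases sgn4_spec (hy - py + c) with h1 | h1 <;> rcases sgn4_spec (hw - pw + c) with h2 | h2 <;>
      rw [h1.2, h2.2] at s1 <;> first | omega | (exfalso; norm_num at s1)
  rcases k1 with k1 | k1 <;> rcases d1 with d1 | d1 <;> rcases d3 with d3 | d3 <;> omega

theorem square_bas {n : ℕ} (X : Finset (Fin n)) (i : JJ n) :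
    symmDiff (bas X) ({i, starJ i} : Finset (JJ n)) = bas (symmDiff X {i.1}) := by
  have h : symmDiff (bas X) (bas (symmDiff X {i.1})) = ({i, starJ i} : Finset (JJ n)) := by
    obtain ⟨i, c⟩ := i
    ext ⟨a, b⟩
    rw [mem_symmDiff_bas]
    cases b <;> cases c <;> simp [starJ]
  rw [← h]; simp

theorem square_bas2 {n : ℕ} (X : Finset (Fin n)) (i j : JJ n) (hij : i.1 ≠ j.1) :
    symmDiff (bas X) ({i, starJ i, j, starJ j} : Finset (JJ n)) = bas (symmDiff X {i.1, j.1}) := by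
  have h : symmDiff (bas X) (bas (symmDiff X {i.1, j.1})) =
      ({i, starJ i, j, starJ j} : Finset (JJ n)) := by
    obtain ⟨i, c⟩ := i
    obtain ⟨j, d⟩ := j
    ext ⟨a, b⟩
    rw [mem_symmDiff_bas]
    cases b <;> cases c <;> cases d <;> simp [starJ]
  rw [← h]; simp

/-- The index set of a basis. -/
def unbas {n : ℕ} (A : Finset (JJ n)) : Finset (Fin n) :=
  Finset.univ.filter (fun i => ((i, true) : JJ n) ∈ A)

theorem unbas_bas {n : ℕ} (X : Finset (Fin n)) : unbas (bas X) = X := by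
  ext i; simp [unbas, mem_bas]

/-- The induced sign. -/
def indSign {n : ℕ} (ℬ : Finset (Finset (JJ n))) (φ : Finset (Fin n) → ℤ)
    (F A : Finset (JJ n)) : ℤ :=
  if F ∈ ℬ ∧ A ∈ ℬ then sgn4 ((heightF F A : ℤ) - φ (unbas A) + φ (unbas F)) else 0

theorem indSign_bas {n : ℕ} {ℬ : Finset (Finset (JJ n))} (φ : Finset (Fin n) → ℤ)
    {F A : Finset (Fin n)} (hF : bas F ∈ ℬ) (hA : bas A ∈ ℬ) :
    indSign ℬ φ (bas F) (bas A) = sgn4 (((symmDiff F A).card : ℤ) - φ A + φ F) := by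
  rw [indSign, if_pos ⟨hF, hA⟩, unbas_bas, unbas_bas, height_bas]

theorem card_change {n : ℕ} (G H A : Finset (Fin n)) :
    (symmDiff G A).card + (symmDiff H G).card =
      (symmDiff H A).card + 2 * (symmDiff G H ∩ symmDiff G A).card := by
  have e1 : symmDiff H A = symmDiff G H \ symmDiff G A ∪ symmDiff G A \ symmDiff G H := by
    ext x; simp only [Finset.mem_symmDiff, Finset.mem_union, Finset.mem_sdiff]; tauto
  have e2 : Disjoint (symmDiff G H \ symmDiff G A) (symmDiff G A \ symmDiff G H) := disjoint_sdiff_sdiff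
  have e3 := Finset.card_sdiff_add_card_inter (symmDiff G H) (symmDiff G A)
  have e4 := Finset.card_sdiff_add_card_inter (symmDiff G A) (symmDiff G H)
  rw [Finset.inter_comm] at e4
  rw [e1, Finset.card_union_of_disjoint e2, symmDiff_comm H G]
  omega

theorem unique_aux {n : ℕ} {ℬ : Finset (Finset (JJ n))} (hM : IsLagrangianMatroid ℬ)
    (hall : ∀ C ∈ ℬ, ∃ X, C = bas X) {ε : Finset (JJ n) → Finset (JJ n) → ℤ}
    (s s' : Finset (JJ n) → Finset (JJ n) → ℤ) (hs : InducedBy ℬ ε s) (hs' : InducedBy ℬ ε s')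
    (F : Finset (Fin n)) (hF : bas F ∈ ℬ) :
    ∀ (k : ℕ) (A : Finset (Fin n)), bas A ∈ ℬ → (symmDiff F A).card = k →
      s (bas F) (bas A) = s' (bas F) (bas A) := by
  intro k
  induction k using Nat.strong_induction_on with
  | _ k ih =>
    intro A hA hk
    by_cases hne : A = F
    · subst hne; rw [(hs _ hF).1, (hs' _ hF).1]
    obtain ⟨A', hA', hE, h⟩ := descend hM hall F A hF hA hne
    have hlt : (symmDiff F A').card < k := by
      rcases h with ⟨a, hs, hc⟩ | ⟨a, b, hab, hs, hB, hc⟩ <;> omega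
    have e := ih _ hlt A' hA' rfl
    have e1 := (hs _ hF).2 _ _ hE
    have e2 := (hs' _ hF).2 _ _ hE
    by_cases hI : IsInducingEdge ℬ ε (bas F) (bas A) (bas A')
    · rw [e1.1 hI, e2.1 hI, e]
    · rw [e1.2 hI, e2.2 hI, e]

theorem fin4 (g : Fin 4 → ℕ) (k : Fin 4)
    (h : (g 0 ≤ g k ∧ g 1 ≤ g k ∧ g 2 ≤ g k ∧ g 3 ≤ g k) ∨
      (g k ≤ g 0 ∧ g k ≤ g 1 ∧ g k ≤ g 2 ∧ g k ≤ g 3)) :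
    (∀ l : Fin 4, g l ≤ g k) ∨ (∀ l : Fin 4, g k ≤ g l) := by
  rcases h with ⟨q0, q1, q2, q3⟩ | ⟨q0, q1, q2, q3⟩
  · left; intro l; fin_cases l <;> assumption
  · right; intro l; fin_cases l <;> assumption

set_option maxHeartbeats 2000000 in
theorem square_rule {n : ℕ} {ℬ : Finset (Finset (JJ n))}
    (hall : ∀ C ∈ ℬ, ∃ X, C = bas X) (φ : Finset (Fin n) → ℤ)
    (par : ∀ F A, bas F ∈ ℬ → bas A ∈ ℬ → (((symmDiff F A).card : ℤ) - φ A + φ F) % 2 = 0)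
    (hstep : ∀ X Y i, symmDiff X Y = {i} → bas X ∈ ℬ → bas Y ∈ ℬ →
      (φ Y - φ X = 1 ∨ φ Y - φ X = -1)) (F : Finset (Fin n)) (hG : bas F ∈ ℬ) :
    ∀ v : Fin 4 → Finset (JJ n), ShortSquare ℬ v →
    ∀ k : Fin 4,
      ((∀ l m : Fin 4, l ≠ k → m ≠ k →
          indSign ℬ φ (bas F) (v l) = indSign ℬ φ (bas F) (v m)) ∧
        ∃ l : Fin 4, l ≠ k ∧ indSign ℬ φ (bas F) (v l) ≠ indSign ℬ φ (bas F) (v k)) →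
      (∀ l : Fin 4, heightF (bas F) (v l) ≤ heightF (bas F) (v k)) ∨
      (∀ l : Fin 4, heightF (bas F) (v k) ≤ heightF (bas F) (v l)) := by
  rintro v ⟨A, i, j, hij, v0, v1, v2, v3, hv⟩ k ⟨hk1, l, hlk, hl⟩
  have hA : A ∈ ℬ := v0 ▸ hv 0
  obtain ⟨X, rfl⟩ := hall A hA
  rw [square_bas] at v1 v2
  rw [square_bas2 X i j hij] at v3
  have b1 : bas (symmDiff X {i.1}) ∈ ℬ := v1 ▸ hv 1
  have b2 : bas (symmDiff X {j.1}) ∈ ℬ := v2 ▸ hv 2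
  have b3 : bas (symmDiff X {i.1, j.1}) ∈ ℬ := v3 ▸ hv 3
  have d1 := hstep X (symmDiff X {i.1}) i.1 (by simp) hA b1
  have d2 := hstep X (symmDiff X {j.1}) j.1 (by simp) hA b2
  have e3 : symmDiff (symmDiff X {i.1}) {j.1} = symmDiff X {i.1, j.1} := (symmDiff_pair X hij).symm
  have e4 : symmDiff (symmDiff X {j.1}) {i.1} = symmDiff X {i.1, j.1} := by
    rw [Finset.pair_comm]; exact (symmDiff_pair X hij.symm).symm
  have d3 := hstep (symmDiff X {i.1}) (symmDiff X {i.1, j.1}) j.1 (by rw [← e3]; simp) b1 b3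
  have d4 := hstep (symmDiff X {j.1}) (symmDiff X {i.1, j.1}) i.1 (by rw [← e4]; simp) b2 b3
  have K : (((symmDiff F (symmDiff X {i.1})).card : ℤ) - (symmDiff F X).card = 1 ∨
        ((symmDiff F (symmDiff X {i.1})).card : ℤ) - (symmDiff F X).card = -1) ∧
      (((symmDiff F (symmDiff X {j.1})).card : ℤ) - (symmDiff F X).card = 1 ∨
        ((symmDiff F (symmDiff X {j.1})).card : ℤ) - (symmDiff F X).card = -1) ∧
      ((symmDiff F (symmDiff X {i.1, j.1})).card : ℤ) + (symmDiff F X).card =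
        (symmDiff F (symmDiff X {i.1})).card + (symmDiff F (symmDiff X {j.1})).card := by
    have c1 := card_flip F X i.1
    have c2 := card_flip F X j.1
    have c3 := card_flip F (symmDiff X {i.1}) j.1
    have mem : j.1 ∈ symmDiff F (symmDiff X {i.1}) ↔ j.1 ∈ symmDiff F X := by
      simp [Finset.mem_symmDiff, hij.symm]
    rw [e3, mem] at c3
    clear * - c1 c2 c3
    rcases c1 with c1 | c1 <;> rcases c2 with c2 | c2 <;> rcases c3 with c3 | c3 <;>
      first | exact absurd c3.1 c2.1 | exact absurd c2.1 c3.1 | omega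
  obtain ⟨K1, K2, K3⟩ := K
  have p0 := par F X hG hA
  have p1 := par F _ hG b1
  have p2 := par F _ hG b2
  have p3 := par F _ hG b3
  have z0 := indSign_bas φ hG hA
  have z1 := indSign_bas φ hG b1
  have z2 := indSign_bas φ hG b2
  have z3 := indSign_bas φ hG b3
  rw [← v0] at z0
  rw [← v1] at z1
  rw [← v2] at z2
  rw [← v3] at z3
  have t0 := height_bas F X
  have t1 := height_bas F (symmDiff X {i.1})
  have t2 := height_bas F (symmDiff X {j.1})
  have t3 := height_bas F (symmDiff X {i.1, j.1})
  rw [← v0] at t0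
  rw [← v1] at t1
  rw [← v2] at t2
  rw [← v3] at t3
  rw [← t0] at K1 K2 K3 p0 z0
  rw [← t1] at K1 K3 p1 z1
  rw [← t2] at K2 K3 p2 z2
  rw [← t3] at K3 p3 z3
  clear t0 t1 t2 t3
  have hk4 : k = 0 ∨ k = 1 ∨ k = 2 ∨ k = 3 := by
    clear * -; revert k; decide
  obtain ⟨g, hg⟩ : ∃ g : Fin 4 → ℕ, ∀ l, heightF (bas F) (v l) = g l := ⟨_, fun _ => rfl⟩
  simp only [hg] at K1 K2 K3 p0 p1 p2 p3 z0 z1 z2 z3 ⊢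
  clear hg
  generalize φ X = f0 at *
  generalize φ (symmDiff X {i.1}) = f1 at *
  generalize φ (symmDiff X {j.1}) = f2 at *
  generalize φ (symmDiff X {i.1, j.1}) = f3 at *
  rcases hk4 with rfl | rfl | rfl | rfl
  · have s1 := hk1 1 2 (by decide) (by decide)
    have s2 := hk1 1 3 (by decide) (by decide)
    have s3 := hk1 l 1 hlk (by decide)
    rw [s3] at hl
    rw [z1, z2] at s1
    rw [z1, z3] at s2
    rw [z1, z0] at hl
    have := square_core (g 0 : ℤ) (g 1 : ℤ)
      (g 2 : ℤ) (g 3 : ℤ)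
      f0 f1 f2 f3 (φ F)
      p0 p1 p2 p3 d1 d2 d3 d4
      (by omega) (by omega) (by omega) s1 s2 hl
    exact fin4 g _ (by omega)
  · have s1 := hk1 0 3 (by decide) (by decide)
    have s2 := hk1 0 2 (by decide) (by decide)
    have s3 := hk1 l 0 hlk (by decide)
    rw [s3] at hl
    rw [z0, z3] at s1
    rw [z0, z2] at s2
    rw [z0, z1] at hl
    have := square_core (g 1 : ℤ) (g 0 : ℤ)
      (g 3 : ℤ) (g 2 : ℤ)
      f1 f0 f3 f2 (φ F)
      p1 p0 p3 p2 (by omega) d3 d2 (by omega)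
      (by omega) (by omega) (by omega) s1 s2 hl
    exact fin4 g _ (by omega)
  · have s1 := hk1 0 3 (by decide) (by decide)
    have s2 := hk1 0 1 (by decide) (by decide)
    have s3 := hk1 l 0 hlk (by decide)
    rw [s3] at hl
    rw [z0, z3] at s1
    rw [z0, z1] at s2
    rw [z0, z2] at hl
    have := square_core (g 2 : ℤ) (g 0 : ℤ)
      (g 3 : ℤ) (g 1 : ℤ)
      f2 f0 f3 f1 (φ F)
      p2 p0 p3 p1 (by omega) d4 d1 (by omega)
      (by omega) (by omega) (by omega) s1 s2 hl
    exact fin4 g _ (by omega)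
  · have s1 := hk1 1 2 (by decide) (by decide)
    have s2 := hk1 1 0 (by decide) (by decide)
    have s3 := hk1 l 1 hlk (by decide)
    rw [s3] at hl
    rw [z1, z2] at s1
    rw [z1, z0] at s2
    rw [z1, z3] at hl
    have := square_core (g 3 : ℤ) (g 1 : ℤ)
      (g 2 : ℤ) (g 0 : ℤ)
      f3 f1 f2 f0 (φ F)
      p3 p1 p2 p0 (by omega) (by omega) (by omega) (by omega)
      (by omega) (by omega) (by omega) s1 s2 hl
    exact fin4 g _ (by omega)

/-- An orientation `ε` of the matroid polytope of a Lagrangian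
matroid (each short edge directed so that every 2-dimensional face has equally many
short edges directed clockwise and anti-clockwise) induces signs `s(F,·)` by:
`s(F,F) = +1`, opposite signs across inducing edges and equal signs across non-inducing
edges.  This assignment is contradiction-free, yields an orientation of the matroid
relative to each fundamental basis, and different fundamental bases give equivalent
orientations (related by `s(G,A) = s(F,A)·s(F,G)·(−1)^{|G∖(F∪A)|}`): an oriented
Lagrangian matroid polytope defines a unique oriented Lagrangian matroid. -/
theorem polytope_orientation_induces_matroid_orientation {n : ℕ}
    (ℬ : Finset (Finset (JJ n))) (hM : IsLagrangianMatroid ℬ)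
    (ε : Finset (JJ n) → Finset (JJ n) → ℤ)
    (hε : IsPolytopeOrientation ℬ ε) :
    ∃! s : Finset (JJ n) → Finset (JJ n) → ℤ,
      IsOrientation ℬ s ∧ InducedBy ℬ ε s := by
  have hall : ∀ C ∈ ℬ, ∃ X, C = bas X := fun C hC => exists_bas (hM.1 C hC).1 (hM.1 C hC).2
  obtain ⟨φ, h1, h2⟩ := polytope_potential hM hall hε
  have par : ∀ F A, bas F ∈ ℬ → bas A ∈ ℬ → (((symmDiff F A).card : ℤ) - φ A + φ F) % 2 = 0 :=
    fun F A hF hA => parity hM hall hε φ h1 h2 F hF _ A hA rfl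
  have hstep : ∀ X Y i, symmDiff X Y = {i} → bas X ∈ ℬ → bas Y ∈ ℬ →
      (φ Y - φ X = 1 ∨ φ Y - φ X = -1) := by
    intro X Y i h hX hY
    rw [← h1 X Y i h hX hY]
    exact (hε.1 _ _ (short_bas hall h hX hY)).1
  -- sign rule across long edges
  have longrule : ∀ F X Y i j, bas F ∈ ℬ → IsEdge ℬ (bas X) (bas Y) → i ≠ j →
      symmDiff X Y = {i, j} → φ X = φ Y →
      (heightF (bas F) (bas X) = heightF (bas F) (bas Y) →
        indSign ℬ φ (bas F) (bas X) = indSign ℬ φ (bas F) (bas Y)) ∧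
      (heightF (bas F) (bas X) ≠ heightF (bas F) (bas Y) →
        indSign ℬ φ (bas F) (bas X) = -indSign ℬ φ (bas F) (bas Y)) := by
    intro F X Y i j hF hE hij hXY hφ
    have hX := hE.1
    have hY := hE.2.1
    rw [indSign_bas φ hF hX, indSign_bas φ hF hY, height_bas, height_bas, hφ]
    have p1 := par F X hF hX
    have p2 := par F Y hF hY
    rw [hφ] at p1
    refine ⟨fun h => by rw [h], fun h => ?_⟩
    have hc := eq_of_symmDiff hXY
    rw [symmDiff_pair X hij] at hc
    have c1 := card_flip F X i
    have c2 := card_flip F (symmDiff X {i}) j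
    rw [← hc] at c2
    rcases sgn4_spec (((symmDiff F X).card : ℤ) - φ Y + φ F) with g1 | g1 <;>
      rcases sgn4_spec (((symmDiff F Y).card : ℤ) - φ Y + φ F) with g2 | g2 <;>
      rw [g1.2, g2.2] <;> omega
  have longrule' : ∀ F A B, F ∈ ℬ → IsLongEdge ℬ A B →
      (heightF F A = heightF F B → indSign ℬ φ F A = indSign ℬ φ F B) ∧
      (heightF F A ≠ heightF F B → indSign ℬ φ F A = -indSign ℬ φ F B) := by
    intro F A B hF hAB
    obtain ⟨F, rfl⟩ := hall F hF
    obtain ⟨X, rfl⟩ := hall A hAB.1.1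
    obtain ⟨Y, rfl⟩ := hall B hAB.1.2.1
    rcases edge_classify hM X Y hAB.1 with ⟨i, hi⟩ | ⟨i, j, hij, hd, hn⟩
    · exact absurd hAB (not_long_bas hi)
    · exact longrule F X Y i j hF hAB.1 hij hd (h2 X Y i j hij hd hAB.1.1 hAB.1.2.1 hn)
  have self : ∀ F ∈ ℬ, indSign ℬ φ F F = 1 := by
    intro F hF
    obtain ⟨F, rfl⟩ := hall F hF
    rw [indSign_bas φ hF hF]
    simp [sgn4]
  have hind : InducedBy ℬ ε (indSign ℬ φ) := by
    intro F hF
    refine ⟨self F hF, ?_⟩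
    intro A B hE
    obtain ⟨F, rfl⟩ := hall F hF
    obtain ⟨X, rfl⟩ := hall A hE.1
    obtain ⟨Y, rfl⟩ := hall B hE.2.1
    rcases edge_classify hM X Y hE with ⟨i, hi⟩ | ⟨i, j, hij, hd, hn⟩
    · have hX := hE.1
      have hY := hE.2.1
      have hS := short_bas hall hi hX hY
      have hiff : IsInducingEdge ℬ ε (bas F) (bas X) (bas Y) ↔
          (((symmDiff F Y).card < (symmDiff F X).card ∧ φ Y - φ X = 1) ∨
            ((symmDiff F X).card < (symmDiff F Y).card ∧ φ X - φ Y = 1)) := by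
        unfold IsInducingEdge
        rw [height_bas, height_bas, h1 X Y i hi hX hY, h1 Y X i (by rwa [symmDiff_comm]) hY hX]
        have := not_long_bas (ℬ := ℬ) hi
        tauto
      rw [hiff, indSign_bas φ hF hX, indSign_bas φ hF hY]
      have p1 := par F X hF hX
      have p2 := par F Y hF hY
      have st := hstep X Y i hi hX hY
      have c1 := card_flip F X i
      rw [← eq_of_symmDiff hi] at c1
      constructor
      · intro h
        rcases sgn4_spec (((symmDiff F X).card : ℤ) - φ X + φ F) with g1 | g1 <;>
          rcases sgn4_spec (((symmDiff F Y).card : ℤ) - φ Y + φ F) with g2 | g2 <;>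
          rw [g1.2, g2.2] <;> omega
      · intro h
        rcases sgn4_spec (((symmDiff F X).card : ℤ) - φ X + φ F) with g1 | g1 <;>
          rcases sgn4_spec (((symmDiff F Y).card : ℤ) - φ Y + φ F) with g2 | g2 <;>
          rw [g1.2, g2.2] <;> omega
    · have hL := long_bas hij hd hE
      have hr := longrule' _ _ _ hF hL
      have hns := not_short_bas (ℬ := ℬ) hij hd
      have hiff : IsInducingEdge ℬ ε (bas F) (bas X) (bas Y) ↔
          heightF (bas F) (bas X) ≠ heightF (bas F) (bas Y) := by
        unfold IsInducingEdge
        tauto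
      rw [hiff]
      exact ⟨hr.2, fun h => hr.1 (not_not.1 h)⟩
  refine ⟨indSign ℬ φ, ⟨⟨?_, ?_, ?_⟩, hind⟩, ?_⟩
  · intro G A h
    rw [indSign, if_neg (by tauto)]
  · intro G hG
    refine ⟨?_, fun A B h => (longrule' G A B hG h).1, fun A B h => (longrule' G A B hG h).2, ?_,
      self G hG⟩
    · intro A hA
      rw [indSign, if_pos ⟨hG, hA⟩]
      rcases sgn4_spec ((heightF G A : ℤ) - φ (unbas A) + φ (unbas G)) with h | h
      · exact Or.inl h.2
      · exact Or.inr h.2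
    · obtain ⟨F, rfl⟩ := hall G hG
      exact square_rule hall φ par hstep F hG
  · intro G hG H hH A hA
    obtain ⟨G, rfl⟩ := hall G hG
    obtain ⟨H, rfl⟩ := hall H hH
    obtain ⟨A, rfl⟩ := hall A hA
    rw [indSign_bas φ hG hA, indSign_bas φ hH hA, indSign_bas φ hH hG, sdiff_bas]
    apply sgn4_mul _ _ _ _ (par G A hG hA) (par H A hH hA) (par H G hH hG)
    have := card_change G H A
    push_cast [← @Nat.cast_inj ℤ] at this
    linarith
  · rintro s' ⟨hO, hI⟩
    funext F A
    by_cases hFA : F ∈ ℬ ∧ A ∈ ℬ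
    · obtain ⟨hF, hA⟩ := hFA
      obtain ⟨F, rfl⟩ := hall F hF
      obtain ⟨A, rfl⟩ := hall A hA
      exact unique_aux hM hall s' _ hI hind F hF _ A hA rfl
    · rw [hO.1 F A (by tauto), indSign, if_neg hFA]
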